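/- arXiv:2210.01183 — 2 statements merged into one kernel-verified Lean document; each statement's English description precedes it below -/
import Mathlib

section
/- Let F be a finite field and V ⊆ \bar{F}^n a variety defined over F that is cut out by polynomials of degree at most d. Then |V(F)|/|F|^n ≤ (d/|F|)^{codim V}, where V(F) = V ∩ F^n. -/
/-- A (possibly reducible) affine subvariety of `K^n`: the common zero set of a collection of
polynomials. -/
def IsSubvariety {K : Type*} [Field K] {n : ℕ} (W : Set (Fin n → K)) : Prop :=
  ∃ S : Set (MvPolynomial (Fin n) K), W = {x | ∀ p ∈ S, MvPolynomial.eval x p = 0}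

/-- An irreducible subvariety: a nonempty subvariety that cannot be covered by two subvarieties
unless it is contained in one of them. -/
def IsIrreducibleSubvariety {K : Type*} [Field K] {n : ℕ} (W : Set (Fin n → K)) : Prop :=
  IsSubvariety W ∧ W.Nonempty ∧ ∀ W₁ W₂ : Set (Fin n → K), IsSubvariety W₁ → IsSubvariety W₂ →
    W ⊆ W₁ ∪ W₂ → W ⊆ W₁ ∨ W ⊆ W₂

/-- The dimension of a variety `V`: the maximal length `k` of a strict chain
`C 0 ⊊ C 1 ⊊ ⋯ ⊊ C k` of irreducible subvarieties contained in `V`. -/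
noncomputable def varDim {K : Type*} [Field K] {n : ℕ} (V : Set (Fin n → K)) : ℕ :=
  sSup {k | ∃ C : Fin (k + 1) → Set (Fin n → K),
    (∀ i, IsIrreducibleSubvariety (C i)) ∧ (∀ i, C i ⊆ V) ∧ StrictMono C}

open scoped BigOperators

open MvPolynomial in
lemma height_vanishingIdeal_singleton {K : Type*} [Field K] [IsAlgClosed K] {n : ℕ}
    (x : Fin n → K) :
    (n : ℕ∞) ≤ (vanishingIdeal K {x}).height := by
  have hle : (n : WithBot ℕ∞) ≤ ringKrullDim (MvPolynomial (Fin n) K) := by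
    rw [MvPolynomial.ringKrullDim_of_isNoetherianRing]
    simp
  have key : ringKrullDim (MvPolynomial (Fin n) K) ≤ ((vanishingIdeal K {x}).height : ℕ∞) := by
    rw [ringKrullDim_le_iff_isMaximal_height_le]
    intro M hM
    obtain ⟨y, rfl⟩ := isMaximal_iff_eq_vanishingIdeal_singleton.mp hM
    let T : (Fin n → K) → MvPolynomial (Fin n) K →ₐ[K] MvPolynomial (Fin n) K :=
      fun v => aeval fun i => X i + C (v i)
    have hT : ∀ v : Fin n → K, (T v).comp (T (-v)) = AlgHom.id K _ := by
      intro v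
      ext i : 1
      simp [T]
    let e : MvPolynomial (Fin n) K ≃ₐ[K] MvPolynomial (Fin n) K :=
      AlgEquiv.ofAlgHom (T (x - y)) (T (-(x - y))) (hT _) (by simpa using hT (-(x - y)))
    have hcomap : (vanishingIdeal K {y}).comap e.toRingEquiv = vanishingIdeal K {x} := by
      ext p
      have : (aeval y).comp (T (x - y)) = aeval x := by
        ext i : 1
        simp [T]
      have h2 := DFunLike.congr_fun this p
      simp only [Ideal.mem_comap, mem_vanishingIdeal_singleton_iff]
      rw [← h2]
      rfl
    rw [← hcomap, RingEquiv.height_comap]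
  exact_mod_cast hle.trans key

namespace MvPolynomial
lemma aeval_smul_of_isHomogeneous {σ K A : Type*} [CommSemiring K] [CommSemiring A] [Algebra K A]
    {φ : MvPolynomial σ K} {k : ℕ} (hφ : φ.IsHomogeneous k) (c : σ → K) (y : A) :
    aeval (fun i => c i • y) φ = eval c φ • y ^ k := by
  rw [aeval_def, eval₂_eq, eval_eq, Finset.sum_smul]
  refine Finset.sum_congr rfl fun d hd => ?_
  simp only [smul_pow, Finset.prod_smul, Finset.prod_pow_eq_pow_sum]
  rw [← hφ.degree_eq_sum_deg_support hd, Algebra.smul_def, Algebra.smul_def, map_mul, mul_assoc]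

lemma aeval_mem_pow_of_isHomogeneous {σ K A : Type*} [CommRing K] [CommRing A] [Algebra K A]
    {φ : MvPolynomial σ K} {k : ℕ} (hφ : φ.IsHomogeneous k) (f : σ → A) :
    aeval f φ ∈ Ideal.span (Set.range f) ^ k := by
  rw [aeval_def, eval₂_eq]
  refine Ideal.sum_mem _ fun d hd => Ideal.mul_mem_left _ _ ?_
  rw [hφ.degree_eq_sum_deg_support hd, ← Finset.prod_pow_eq_pow_sum]
  exact Ideal.prod_mem_prod fun i _ => Ideal.pow_mem_pow (Ideal.subset_span (Set.mem_range_self i)) _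

/-- Analytic independence of a system of parameters. -/
lemma eq_zero_of_aeval_mem_mul_pow {K R : Type*} [Field K] [Infinite K] [CommRing R]
    [IsNoetherianRing R] [Algebra K R] {n : ℕ} {m : Ideal R} {f : Fin n → R}
    (hm : m ∈ (Ideal.span (Set.range f)).minimalPrimes) (hn : (n : ℕ∞) ≤ m.height)
    {φ : MvPolynomial (Fin n) K} {k : ℕ} (hφ : φ.IsHomogeneous k)
    (hmem : aeval f φ ∈ m * Ideal.span (Set.range f) ^ k) : φ = 0 := by
  classical
  have hmp : m.IsPrime := hm.1.1
  have hunit : ∀ u : K, algebraMap K R u ∈ m → u = 0 := by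
    intro u hu
    by_contra hne
    exact hmp.ne_top (Ideal.eq_top_of_isUnit_mem _ hu ((IsUnit.mk0 u hne).map _))
  by_contra hφ0
  obtain ⟨c, hc⟩ : ∃ c, eval c φ ≠ 0 := by
    by_contra! h
    exact hφ0 (MvPolynomial.funext fun c => by simpa using h c)
  rcases eq_or_ne c 0 with rfl | hc0
  · have hk : k = 0 := by
      by_contra hk
      have := aeval_smul_of_isHomogeneous hφ (0 : Fin n → K) (0 : K)
      apply hc
      simpa [hk, aeval_eq_eval] using this
    subst hk
    have hC := (totalDegree_eq_zero_iff_eq_C).mp (Nat.le_zero.mp hφ.totalDegree_le)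
    rw [hC, aeval_C] at hmem
    have := hunit _ (Ideal.mul_le_left hmem)
    rw [this] at hC
    exact hφ0 (by simpa using hC)
  obtain ⟨l, hl⟩ : ∃ l, c l ≠ 0 := Function.ne_iff.mp hc0
  set c' : Fin n → K := fun i => (c l)⁻¹ * c i with hc'
  have hc'l : c' l = 1 := by simp [hc', hl]
  have hu : eval c' φ ≠ 0 := by
    have h := aeval_smul_of_isHomogeneous hφ c (c l)⁻¹
    have h2 : (fun i => c i • (c l)⁻¹) = c' := by ext i; simp [hc', mul_comm]
    rw [h2] at h
    rw [← aeval_eq_eval, h]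
    simp [hc, hl]
  set s : Finset R := (Finset.univ.erase l).image fun i => f i - c' i • f l with hs
  set J : Ideal R := Ideal.span (s : Set R) with hJ
  have hfJ : ∀ i, f i - c' i • f l ∈ J := by
    intro i
    rcases eq_or_ne i l with rfl | hi
    · simp [hc'l]
    · refine Ideal.subset_span ?_
      simp only [hs, Finset.coe_image, Finset.coe_erase]
      exact ⟨i, by simpa using hi, rfl⟩
  have hJq : J ≤ Ideal.span (Set.range f) := by
    rw [hJ, Ideal.span_le]
    intro x hx
    simp only [hs, Finset.coe_image] at hx
    obtain ⟨i, -, rfl⟩ := hx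
    refine Ideal.sub_mem _ (Ideal.subset_span ⟨i, rfl⟩) ?_
    rw [Algebra.smul_def]
    exact Ideal.mul_mem_left _ _ (Ideal.subset_span ⟨l, rfl⟩)
  have hmk : ∀ i, Ideal.Quotient.mk J (f i) = c' i • Ideal.Quotient.mk J (f l) := by
    intro i
    have := Ideal.Quotient.eq.mpr (hfJ i)
    rw [this]
    exact map_smul (Ideal.Quotient.mkₐ K J) _ _
  have hφmk : Ideal.Quotient.mk J (aeval f φ)
      = eval c' φ • Ideal.Quotient.mk J (f l) ^ k := by
    rw [← aeval_smul_of_isHomogeneous hφ, ← Ideal.Quotient.mkₐ_eq_mk K, ← AlgHom.comp_apply, comp_aeval]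
    congr 2
    ext i
    exact hmk i
  have hqmap : (Ideal.span (Set.range f)).map (Ideal.Quotient.mk J)
      = Ideal.span {Ideal.Quotient.mk J (f l)} := by
    rw [Ideal.map_span]
    apply le_antisymm
    · rw [Ideal.span_le]
      rintro _ ⟨_, ⟨i, rfl⟩, rfl⟩
      rw [hmk i, Algebra.smul_def]
      exact Ideal.mul_mem_left _ _ (Ideal.mem_span_singleton_self _)
    · rw [Ideal.span_le, Set.singleton_subset_iff]
      exact Ideal.subset_span ⟨f l, ⟨l, rfl⟩, rfl⟩
  have hmem' := Ideal.mem_map_of_mem (Ideal.Quotient.mk J) hmem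
  rw [Ideal.map_mul, Ideal.map_pow, hqmap, Ideal.span_singleton_pow,
    Ideal.mem_mul_span_singleton] at hmem'
  obtain ⟨z, hz, hzeq⟩ := hmem'
  obtain ⟨z, hzm, rfl⟩ := (Ideal.mem_map_iff_of_surjective _ Ideal.Quotient.mk_surjective).mp hz
  have hprod : (algebraMap K R (eval c' φ) - z) * f l ^ k ∈ J := by
    rw [← Ideal.Quotient.eq_zero_iff_mem, map_mul, map_sub, map_pow, sub_mul, hzeq, hφmk,
      Algebra.smul_def]
    exact sub_self _
  have hmin : m ∈ J.minimalPrimes := by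
    refine ⟨⟨hmp, hJq.trans hm.1.2⟩, fun P ⟨hP, hJP⟩ hPm => ?_⟩
    refine hm.2 ⟨hP, ?_⟩ hPm
    have hflP : f l ∈ P := by
      rcases hP.mem_or_mem (hJP hprod) with h | h
      · exact absurd (hunit _ (by simpa using Ideal.add_mem _ (hPm h) hzm)) hu
      · exact hP.mem_of_pow_mem _ h
    rw [Ideal.span_le]
    rintro _ ⟨i, rfl⟩
    have h1 : c' i • f l ∈ P := by
      rw [Algebra.smul_def]; exact Ideal.mul_mem_left _ _ hflP
    simpa using Ideal.add_mem _ (hJP (hfJ i)) h1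
  have h1 := hn.trans (Ideal.height_le_card_of_mem_minimalPrimes_span_finset hmin)
  have h2 : s.card < n := by
    refine (Finset.card_image_le).trans_lt ?_
    rw [Finset.card_erase_of_mem (Finset.mem_univ l)]
    simp only [Finset.card_univ, Fintype.card_fin]
    have := l.pos
    omega
  exact absurd (by exact_mod_cast h1) (not_le.mpr h2)

end MvPolynomial

namespace MvPolynomial

lemma aeval_mem_pow_succ {σ K A : Type*} [CommRing K] [CommRing A] [Algebra K A]
    {p : MvPolynomial σ K} {k : ℕ} (hp : ∀ l ≤ k, homogeneousComponent l p = 0) (f : σ → A) :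
    aeval f p ∈ Ideal.span (Set.range f) ^ (k + 1) := by
  rw [← sum_homogeneousComponent p, map_sum]
  refine Ideal.sum_mem _ fun l _ => ?_
  rcases le_or_gt l k with h | h
  · simp [hp l h]
  · exact Ideal.pow_le_pow_right h
      (aeval_mem_pow_of_isHomogeneous (homogeneousComponent_isHomogeneous l p) f)

/-- If `f` is a system of parameters at each `m i`, then elements `b i` that separate the `m i` are
linearly independent over `K[f]`. -/
lemma eq_zero_of_sum_mul_aeval_eq_zero {K R ι : Type*} [Field K] [Infinite K] [CommRing R]
    [IsNoetherianRing R] [Algebra K R] [Fintype ι] {n : ℕ} {m : ι → Ideal R} {f : Fin n → R}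
    (hm : ∀ i, m i ∈ (Ideal.span (Set.range f)).minimalPrimes)
    (hn : ∀ i, (n : ℕ∞) ≤ (m i).height) {b : ι → R} (hb : ∀ i, 1 - b i ∈ m i)
    (hb' : ∀ i j, j ≠ i → b j ∈ m i) {a : ι → MvPolynomial (Fin n) K}
    (ha : ∑ i, b i * aeval f (a i) = 0) : a = 0 := by
  classical
  suffices h : ∀ k i, homogeneousComponent k (a i) = 0 by
    ext1 i
    rw [Pi.zero_apply, ← sum_homogeneousComponent (a i)]
    exact Finset.sum_eq_zero fun k _ => h k i
  intro k
  induction k using Nat.strong_induction_on with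
  | _ k ih =>
  intro i
  set q := Ideal.span (Set.range f) with hq
  have hqm : q ≤ m i := (hm i).1.2
  have hhom := fun j => homogeneousComponent_isHomogeneous k (a j)
  refine eq_zero_of_aeval_mem_mul_pow (hm i) (hn i) (hhom i) ?_
  have hrest : ∀ j, aeval f (a j) - aeval f (homogeneousComponent k (a j)) ∈ m i * q ^ k := by
    intro j
    have h : aeval f (a j - homogeneousComponent k (a j)) ∈ q ^ (k + 1) := by
      refine aeval_mem_pow_succ (fun l hl => ?_) f
      rw [map_sub, homogeneousComponent_of_mem (hhom j)]
      rcases hl.eq_or_lt with rfl | hl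
      · simp
      · simp [ih l hl j, hl.ne]
    rw [pow_succ'] at h
    simpa using Ideal.mul_mono_left hqm h
  have hmem : ∀ j, b j * aeval f (a j) -
      (if j = i then aeval f (homogeneousComponent k (a j)) else 0) ∈ m i * q ^ k := by
    intro j
    have hpow := aeval_mem_pow_of_isHomogeneous (hhom j) f
    have h1 := Ideal.mul_mem_left _ (b j) (hrest j)
    split_ifs with hj
    · subst hj
      have h2 := Ideal.mul_mem_mul (hb j) hpow
      have := Ideal.sub_mem _ h1 h2
      ring_nf at this ⊢
      exact this
    · have h2 := Ideal.mul_mem_mul (hb' i j hj) hpow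
      have := Ideal.add_mem _ h1 h2
      ring_nf at this ⊢
      exact this
  have hsum := Ideal.sum_mem _ fun j (_ : j ∈ Finset.univ) => hmem j
  rw [Finset.sum_sub_distrib, ha, Finset.sum_ite_eq' Finset.univ i, if_pos (Finset.mem_univ i),
    zero_sub, neg_mem_iff] at hsum
  exact hsum

end MvPolynomial

/-- If `c` grows at most polynomially and `N * c M ≤ D * c (M + B)` for all `M`, then `N ≤ D`. -/
lemma le_of_forall_mul_le_mul_shift {N D B n : ℕ} {c : ℕ → ℕ} (hD : 0 < D) (hc0 : 0 < c 0)
    (hc : ∀ M, c M ≤ (M + 1) ^ n) (h : ∀ M, N * c M ≤ D * c (M + B)) : N ≤ D := by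
  by_contra! hlt
  have hiter : ∀ k, N ^ k * c 0 ≤ D ^ k * c (k * B) := by
    intro k
    induction k with
    | zero => simp
    | succ k ih =>
      calc N ^ (k + 1) * c 0 = N * (N ^ k * c 0) := by ring
        _ ≤ N * (D ^ k * c (k * B)) := by gcongr
        _ = D ^ k * (N * c (k * B)) := by ring
        _ ≤ D ^ k * (D * c (k * B + B)) := Nat.mul_le_mul_left _ (h _)
        _ = D ^ (k + 1) * c ((k + 1) * B) := by ring_nf
  have hbound : ∀ k, N ^ k ≤ D ^ k * ((B + 1) ^ n * (k + 1) ^ n) := by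
    intro k
    calc N ^ k ≤ N ^ k * c 0 := Nat.le_mul_of_pos_right _ hc0
      _ ≤ D ^ k * c (k * B) := hiter k
      _ ≤ D ^ k * (k * B + 1) ^ n := Nat.mul_le_mul_left _ (hc _)
      _ ≤ D ^ k * ((B + 1) ^ n * (k + 1) ^ n) := by
        rw [← mul_pow]
        gcongr
        nlinarith
  have hD' : (0 : ℝ) < D := by exact_mod_cast hD
  set r : ℝ := N / D with hr
  have hr1 : 1 < r := by
    rw [hr, one_lt_div hD']
    exact_mod_cast hlt
  have hlim := (tendsto_pow_const_div_const_pow_of_one_lt n hr1).comp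
    (Filter.tendsto_add_atTop_nat 1)
  have hpos : (0 : ℝ) < 1 / ((B + 1) ^ n * r) := by positivity
  obtain ⟨k, hk⟩ := (hlim.eventually_lt_const hpos).exists
  have hb : r ^ k ≤ (B + 1) ^ n * (k + 1) ^ n := by
    rw [hr, div_pow, div_le_iff₀' (by positivity)]
    exact_mod_cast hbound k
  have hr0 : 0 < r := by linarith
  simp only [Function.comp_apply, Nat.cast_add, Nat.cast_one] at hk
  rw [div_lt_div_iff₀ (by positivity) (by positivity), pow_succ] at hk
  nlinarith

namespace MvPolynomial

/-- The exponents of `w`-weighted degree at most `M`. -/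
def weightedExponents {n : ℕ} (w : Fin n → ℕ) (M : ℕ) : Set (Fin n →₀ ℕ) :=
  {e | ∑ i, e i * w i ≤ M}

lemma card_weightedExponents_one_le {n : ℕ} (M : ℕ) :
    Finite (weightedExponents (fun _ : Fin n => 1) M) ∧
      Nat.card (weightedExponents (fun _ : Fin n => 1) M) ≤ (M + 1) ^ n := by
  have hlt : ∀ (e : weightedExponents (fun _ : Fin n => 1) M) (i : Fin n), e.1 i < M + 1 := by
    intro e i
    have h := e.2
    simp only [weightedExponents, mul_one, Set.mem_ofPred_eq] at h
    exact Nat.lt_succ_of_le ((Finset.single_le_sum (fun _ _ => Nat.zero_le _)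
      (Finset.mem_univ i)).trans h)
  let g : weightedExponents (fun _ : Fin n => 1) M → (Fin n → Fin (M + 1)) :=
    fun e i => ⟨e.1 i, hlt e i⟩
  have hg : Function.Injective g := by
    intro e e' h
    ext i
    exact congrArg Fin.val (congrFun h i)
  refine ⟨Finite.of_injective g hg, ?_⟩
  simpa using Nat.card_le_card_of_injective g hg

lemma card_weightedExponents_one_le_mul {n : ℕ} {w : Fin n → ℕ} (hw : ∀ i, 0 < w i) (M : ℕ) :
    Nat.card (weightedExponents (fun _ : Fin n => 1) M) ≤
      (∏ i, w i) * Nat.card (weightedExponents w M) := by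
  have hsub : weightedExponents w M ⊆ weightedExponents (fun _ => 1) M := by
    intro e he
    exact le_trans (Finset.sum_le_sum fun i _ => Nat.mul_le_mul_left _ (hw i)) he
  have hfin := (card_weightedExponents_one_le (n := n) M).1
  have : Finite (weightedExponents w M) := Finite.Set.subset _ hsub
  let g : weightedExponents (fun _ : Fin n => 1) M →
      (∀ i, Fin (w i)) × weightedExponents w M := fun e =>
    (fun i => ⟨e.1 i % w i, Nat.mod_lt _ (hw i)⟩,
      ⟨Finsupp.equivFunOnFinite.symm fun i => e.1 i / w i, by
        have h := e.2
        simp only [weightedExponents, mul_one, Set.mem_ofPred_eq] at h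
        refine le_trans (Finset.sum_le_sum fun i _ => ?_) h
        exact Nat.div_mul_le_self _ _⟩)
  have hg : Function.Injective g := by
    intro e e' h
    ext i
    have h1 : e.1 i % w i = e'.1 i % w i := congrArg Fin.val (congrFun (congrArg Prod.fst h) i)
    have h2 : e.1 i / w i = e'.1 i / w i :=
      DFunLike.congr_fun (congrArg Subtype.val (congrArg Prod.snd h)) i
    rw [← Nat.div_add_mod (e.1 i) (w i), h1, h2, Nat.div_add_mod]
  have := Nat.card_le_card_of_injective g hg
  rw [Nat.card_prod] at this
  simpa [Nat.card_pi] using this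

lemma restrictTotalDegree_eq_restrictSupport_weightedExponents (K : Type*) [CommSemiring K]
    (n M : ℕ) :
    restrictTotalDegree (Fin n) K M = restrictSupport K (weightedExponents (fun _ => 1) M) := by
  unfold restrictTotalDegree weightedExponents
  congr 1
  ext e
  simp [Finsupp.sum_fintype]

lemma totalDegree_aeval_le_of_mem_restrictSupport {K : Type*} [CommSemiring K] {n M : ℕ}
    {σ : Type*} {w : Fin n → ℕ} {f : Fin n → MvPolynomial σ K}
    (hf : ∀ i, (f i).totalDegree ≤ w i) {p : MvPolynomial (Fin n) K}
    (hp : p ∈ restrictSupport K (weightedExponents w M)) : (aeval f p).totalDegree ≤ M := by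
  rw [aeval_def, eval₂_eq']
  refine totalDegree_finsetSum_le fun e he => ?_
  refine (totalDegree_mul _ _).trans ?_
  rw [algebraMap_eq, totalDegree_C, zero_add]
  refine (totalDegree_finsetProd _ _).trans (le_trans (Finset.sum_le_sum fun i _ => ?_)
    ((mem_restrictSupport_iff K).mp hp he))
  exact (totalDegree_pow _ _).trans (Nat.mul_le_mul_left _ (hf i))

/-- Bézout's inequality: `n` polynomials in `n` variables have at most `∏ i, deg (f i)` isolated
common zeros. -/
theorem card_le_prod_totalDegree {K ι : Type*} [Field K] [IsAlgClosed K] [Fintype ι] {n : ℕ}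
    {p : ι → Fin n → K} (hp : Function.Injective p) {f : Fin n → MvPolynomial (Fin n) K}
    {w : Fin n → ℕ} (hf : ∀ i, (f i).totalDegree ≤ w i)
    (hmin : ∀ j, vanishingIdeal K {p j} ∈ (Ideal.span (Set.range f)).minimalPrimes) :
    Fintype.card ι ≤ ∏ i, w i := by
  classical
  rcases isEmpty_or_nonempty ι with h | ⟨⟨j₀⟩⟩
  · simp
  have : Infinite K := IsAlgClosed.instInfinite
  have hmax : ∀ j, (vanishingIdeal K {p j}).IsMaximal := fun j =>
    isMaximal_iff_eq_vanishingIdeal_singleton.mpr ⟨p j, rfl⟩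
  have hcop : Pairwise (Function.onFun IsCoprime fun j => vanishingIdeal K {p j}) := by
    intro i j hij
    have := hmax i
    have := hmax j
    refine Ideal.isCoprime_of_isMaximal fun h => hij (hp ?_)
    ext l
    have h1 : X l - C (p i l) ∈ vanishingIdeal K {p j} := by
      rw [← show vanishingIdeal K {p i} = vanishingIdeal K {p j} from h,
        mem_vanishingIdeal_singleton_iff]
      simp
    rw [mem_vanishingIdeal_singleton_iff] at h1
    simpa [sub_eq_zero, eq_comm] using h1
  choose b hb using fun j : ι => Ideal.exists_forall_sub_mem_ideal hcop (Pi.single j 1)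
  have hindep : ∀ a : ι → MvPolynomial (Fin n) K, ∑ j, b j * aeval f (a j) = 0 → a = 0 := by
    intro a ha
    refine eq_zero_of_sum_mul_aeval_eq_zero hmin
      (fun j => height_vanishingIdeal_singleton (p j)) (fun i => ?_) (fun i j hij => ?_) ha
    · simpa using neg_mem (hb i i)
    · simpa [hij.symm] using hb j i
  have hw : ∀ i, 0 < w i := by
    intro i
    by_contra! h0
    have hC := totalDegree_eq_zero_iff_eq_C.mp (Nat.le_zero.mp ((hf i).trans h0))
    have hmem : f i ∈ vanishingIdeal K {p j₀} := (hmin j₀).1.2 (Ideal.subset_span ⟨i, rfl⟩)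
    rw [hC, mem_vanishingIdeal_singleton_iff, aeval_C] at hmem
    have hfi : f i = 0 := by
      rw [hC, show coeff 0 (f i) = 0 from hmem, C_0]
    have := congrFun (hindep (fun _ => X i) (by simp [hfi])) j₀
    exact X_ne_zero i this
  set B := Finset.univ.sup fun j => (b j).totalDegree with hB
  refine le_of_forall_mul_le_mul_shift (n := n) (B := B)
    (c := fun M => Nat.card (weightedExponents (fun _ : Fin n => 1) M))
    (Finset.prod_pos fun i _ => hw i) ?_ (fun M => (card_weightedExponents_one_le M).2) ?_
  · have := (card_weightedExponents_one_le (n := n) 0).1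
    rw [Nat.card_pos_iff]
    exact ⟨⟨0, by simp [weightedExponents]⟩, this⟩
  intro M
  have hfin := (card_weightedExponents_one_le (n := n) (M + B)).1
  let Φ : (ι → MvPolynomial (Fin n) K) →ₗ[K] MvPolynomial (Fin n) K :=
    ∑ j, (LinearMap.mulLeft K (b j)) ∘ₗ (aeval f).toLinearMap ∘ₗ LinearMap.proj j
  have hΦ : ∀ a, Φ a = ∑ j, b j * aeval f (a j) := by
    intro a
    simp [Φ]
  let Ψ : (ι → restrictSupport K (weightedExponents w M)) →ₗ[K]
      restrictSupport K (weightedExponents (fun _ : Fin n => 1) (M + B)) :=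
    (Φ ∘ₗ LinearMap.pi fun j => Submodule.subtype _ ∘ₗ LinearMap.proj j).codRestrict _ (by
      intro a
      rw [← restrictTotalDegree_eq_restrictSupport_weightedExponents, mem_restrictTotalDegree,
        LinearMap.comp_apply, hΦ]
      refine totalDegree_finsetSum_le fun j _ => (totalDegree_mul _ _).trans ?_
      rw [add_comm M]
      exact add_le_add (Finset.le_sup (f := fun j => (b j).totalDegree) (Finset.mem_univ j))
        (totalDegree_aeval_le_of_mem_restrictSupport hf (a j).2))
  have hΨ : Function.Injective Ψ := by
    rw [← LinearMap.ker_eq_bot, LinearMap.ker_eq_bot']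
    intro a ha
    have h0 := hindep (fun j => (a j).1) ((hΦ _).symm.trans (congrArg Subtype.val ha))
    ext1 j
    exact Subtype.ext (congrFun h0 j)
  have : Module.Finite K (restrictSupport K (weightedExponents (fun _ : Fin n => 1) (M + B))) :=
    Module.Finite.of_basis (basisRestrictSupport K _)
  have hrank := LinearMap.finrank_le_finrank_of_injective hΨ
  have hfin' : Finite (weightedExponents w M) := by
    refine Finite.Set.subset (weightedExponents (fun _ : Fin n => 1) (M + B)) fun e he => ?_
    refine le_trans (Finset.sum_le_sum fun i _ => Nat.mul_le_mul_left _ (hw i)) ?_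
    exact le_trans he (Nat.le_add_right _ _)
  have : Module.Finite K (restrictSupport K (weightedExponents w M)) :=
    Module.Finite.of_basis (basisRestrictSupport K _)
  rw [Module.finrank_pi_fintype, Finset.sum_const, Finset.card_univ, smul_eq_mul,
    Module.finrank_eq_nat_card_basis (basisRestrictSupport K _),
    Module.finrank_eq_nat_card_basis (basisRestrictSupport K _)] at hrank
  calc Fintype.card ι * Nat.card (weightedExponents (fun _ : Fin n => 1) M)
      ≤ Fintype.card ι * ((∏ i, w i) * Nat.card (weightedExponents w M)) :=
        Nat.mul_le_mul_left _ (card_weightedExponents_one_le_mul hw M)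
    _ = (∏ i, w i) * (Fintype.card ι * Nat.card (weightedExponents w M)) := by ring
    _ ≤ _ := Nat.mul_le_mul_left _ hrank

end MvPolynomial

/-- A generic element `g` of `W` cuts down the dimension of `I` by one, unless the dimension of the
ideal generated by `W` prevents it. -/
lemma exists_mem_forall_coheight_le {K R : Type*} [Field K] [Infinite K] [CommRing R]
    [IsNoetherianRing R] [Algebra K R] {I : Ideal R} {W : Submodule K R} {c : ℕ}
    (hI : ∀ P : PrimeSpectrum R, I ≤ P.asIdeal → Order.coheight P ≤ (c + 1 : ℕ))
    (hW : ∀ P : PrimeSpectrum R, (∀ g ∈ W, g ∈ P.asIdeal) → Order.coheight P ≤ c) :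
    ∃ g ∈ W, ∀ P : PrimeSpectrum R, I ≤ P.asIdeal → g ∈ P.asIdeal → Order.coheight P ≤ c := by
  classical
  have hfin : {Q ∈ I.minimalPrimes | ¬ ∀ g ∈ W, g ∈ Q}.Finite :=
    (Ideal.finite_minimalPrimes_of_isNoetherianRing R I).subset fun _ h => h.1
  let s : Finset (Subspace K W) :=
    hfin.toFinset.image fun Q => (Q.restrictScalars K).comap W.subtype
  have hs : ⊤ ∉ s := by
    intro h
    obtain ⟨Q, hQ, hQtop⟩ := Finset.mem_image.mp h
    refine (hfin.mem_toFinset.mp hQ).2 fun g hg => ?_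
    have : (⟨g, hg⟩ : W) ∈ (Q.restrictScalars K).comap W.subtype := by
      rw [hQtop]
      trivial
    exact this
  obtain ⟨g, hg⟩ := (Set.ne_univ_iff_exists_notMem _).mp
    (Subspace.biUnion_ne_univ_of_top_notMem hs)
  refine ⟨g, g.2, fun P hIP hgP => ?_⟩
  obtain ⟨Q, hQ, hQP⟩ := Ideal.exists_minimalPrimes_le hIP
  by_cases hWQ : ∀ g ∈ W, g ∈ Q
  · exact hW P fun g hg => hQP (hWQ g hg)
  · have hgQ : (g : R) ∉ Q := by
      intro hmem
      refine hg (Set.mem_biUnion (Finset.mem_image_of_mem _ (hfin.mem_toFinset.mpr ⟨hQ, hWQ⟩)) ?_)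
      exact hmem
    have hlt : (⟨Q, hQ.1.1⟩ : PrimeSpectrum R) < P :=
      lt_of_le_of_ne hQP fun h => hgQ (by rw [← h] at hgP; exact hgP)
    have h1 := (Order.coheight_add_one_le hlt).trans (hI ⟨Q, hQ.1.1⟩ hQ.1.2)
    rw [Nat.cast_add, Nat.cast_one] at h1
    exact (ENat.add_le_add_iff_right ENat.one_ne_top).mp h1

lemma exists_forall_mem_forall_coheight_le {K R : Type*} [Field K] [Infinite K] [CommRing R]
    [IsNoetherianRing R] [Algebra K R] {n : ℕ} {W : ℕ → Submodule K R}
    (hn : ∀ P : PrimeSpectrum R, Order.coheight P ≤ n)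
    (hW : ∀ i < n, ∀ P : PrimeSpectrum R, (∀ g ∈ W i, g ∈ P.asIdeal) →
      Order.coheight P ≤ (n - i - 1 : ℕ)) {m : ℕ} (hm : m ≤ n) :
    ∃ f : ℕ → R, (∀ i, f i ∈ W i) ∧
      ∀ P : PrimeSpectrum R, (∀ i < m, f i ∈ P.asIdeal) → Order.coheight P ≤ (n - m : ℕ) := by
  induction m with
  | zero => exact ⟨0, fun i => (W i).zero_mem, fun P _ => hn P⟩
  | succ m ih =>
    obtain ⟨f, hfW, hf⟩ := ih (by omega)
    obtain ⟨g, hgW, hg⟩ := exists_mem_forall_coheight_le (I := Ideal.span (f '' Set.Iio m))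
      (W := W m) (c := n - m - 1) (fun P hP => by
        rw [Nat.sub_add_cancel (by omega)]
        exact hf P fun i hi => hP (Ideal.subset_span ⟨i, hi, rfl⟩)) (hW m hm)
    refine ⟨Function.update f m g, fun i => ?_, fun P hP => hg P ?_ ?_⟩
    · rcases eq_or_ne i m with rfl | hi
      · simpa using hgW
      · simpa [hi] using hfW i
    · rw [Ideal.span_le]
      rintro _ ⟨i, hi, rfl⟩
      have := hP i (Nat.lt_succ_of_lt hi)
      rwa [Function.update_of_ne (ne_of_lt hi)] at this
    · simpa using hP m (Nat.lt_succ_self m)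

section

open MvPolynomial

lemma coheight_mvPolynomial_le {K : Type*} [Field K] {n : ℕ}
    (P : PrimeSpectrum (MvPolynomial (Fin n) K)) : Order.coheight P ≤ n := by
  have h : ringKrullDim (MvPolynomial (Fin n) K) = n := by
    rw [MvPolynomial.ringKrullDim_of_isNoetherianRing]
    simp
  have := Order.coheight_le_krullDim P
  rw [ringKrullDim] at h
  rw [h] at this
  exact_mod_cast this

lemma isIrreducibleSubvariety_zeroLocus {K : Type*} [Field K] [IsAlgClosed K] {n : ℕ}
    (P : Ideal (MvPolynomial (Fin n) K)) [hP : P.IsPrime] :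
    IsIrreducibleSubvariety (zeroLocus K P) := by
  have hnull := IsPrime.vanishingIdeal_zeroLocus (K := K) P
  refine ⟨⟨P, rfl⟩, ?_, ?_⟩
  · rw [Set.nonempty_iff_ne_empty]
    intro h
    rw [h, vanishingIdeal_empty] at hnull
    exact hP.ne_top hnull.symm
  · rintro _ _ ⟨S₁, rfl⟩ ⟨S₂, rfl⟩ hcover
    by_contra! h
    obtain ⟨⟨x, hxP, hx⟩, y, hyP, hy⟩ := And.imp Set.not_subset.mp Set.not_subset.mp h
    obtain ⟨p, hp, hpx⟩ : ∃ p ∈ S₁, eval x p ≠ 0 := by simpa using hx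
    obtain ⟨q, hq, hqy⟩ : ∃ q ∈ S₂, eval y q ≠ 0 := by simpa using hy
    have hpq : p * q ∈ P := by
      rw [← hnull]
      intro z hz
      rcases hcover hz with hz | hz
      · rw [map_mul, show aeval z p = 0 from hz p hp, zero_mul]
      · rw [map_mul, show aeval z q = 0 from hz q hq, mul_zero]
    rcases hP.mem_or_mem hpq with h | h
    · exact hpx (hxP p h)
    · exact hqy (hyP q h)

lemma IsSubvariety.zeroLocus_vanishingIdeal {K : Type*} [Field K] {n : ℕ}
    {W : Set (Fin n → K)} (hW : IsSubvariety W) : zeroLocus K (vanishingIdeal K W) = W := by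
  obtain ⟨S, rfl⟩ := hW
  refine Set.Subset.antisymm (fun x hx p hp => ?_) (zeroLocus_vanishingIdeal_le _)
  exact hx p fun y hy => hy p hp

lemma IsIrreducibleSubvariety.isPrime_vanishingIdeal {K : Type*} [Field K] {n : ℕ}
    {W : Set (Fin n → K)} (hW : IsIrreducibleSubvariety W) : (vanishingIdeal K W).IsPrime := by
  obtain ⟨-, ⟨x, hx⟩, hirr⟩ := hW
  refine ⟨fun h => ?_, fun {p q} hpq => ?_⟩
  · have h1 : (1 : MvPolynomial (Fin n) K) ∈ vanishingIdeal K W := by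
      rw [h]
      trivial
    simpa using h1 x hx
  · have := hirr {y | ∀ r ∈ ({p} : Set _), eval y r = 0} {y | ∀ r ∈ ({q} : Set _), eval y r = 0}
      ⟨_, rfl⟩ ⟨_, rfl⟩ fun y hy => by
        have := hpq y hy
        rw [map_mul, mul_eq_zero] at this
        simpa using this
    refine this.imp (fun h y hy => ?_) fun h y hy => ?_
    · exact h hy p rfl
    · exact h hy q rfl

lemma bddAbove_chain_lengths {K : Type*} [Field K] {n : ℕ} (V : Set (Fin n → K)) :
    BddAbove {k | ∃ C : Fin (k + 1) → Set (Fin n → K),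
      (∀ i, IsIrreducibleSubvariety (C i)) ∧ (∀ i, C i ⊆ V) ∧ StrictMono C} := by
  refine ⟨n, ?_⟩
  rintro k ⟨C, hirr, -, hmono⟩
  let s : LTSeries (PrimeSpectrum (MvPolynomial (Fin n) K)) := LTSeries.mk k
    (fun i => ⟨vanishingIdeal K (C i.rev), (hirr i.rev).isPrime_vanishingIdeal⟩) (by
      intro i j hij
      have hlt := hmono (Fin.rev_lt_rev.mpr hij)
      refine lt_of_le_of_ne (vanishingIdeal_anti_mono hlt.le) fun h => hlt.ne ?_
      rw [← (hirr j.rev).1.zeroLocus_vanishingIdeal, ← (hirr i.rev).1.zeroLocus_vanishingIdeal]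
      exact congrArg (fun P : PrimeSpectrum _ => zeroLocus K P.asIdeal) h.symm)
  exact_mod_cast (Order.length_le_coheight_head (p := s)).trans (coheight_mvPolynomial_le _)

/-- The coheight of a prime containing the equations of `V` is at most the dimension of `V`. -/
lemma coheight_le_varDim {K : Type*} [Field K] [IsAlgClosed K] {n : ℕ} {V : Set (Fin n → K)}
    (P : PrimeSpectrum (MvPolynomial (Fin n) K)) (hP : zeroLocus K P.asIdeal ⊆ V) :
    Order.coheight P ≤ varDim V := by
  refine Order.coheight_le fun p hp => ?_
  rw [Nat.cast_le]
  refine le_csSup (bddAbove_chain_lengths V)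
    ⟨fun i => zeroLocus K (p i.rev).asIdeal, fun i => isIrreducibleSubvariety_zeroLocus _,
      fun i => ?_, fun i j hij => ?_⟩
  · refine (zeroLocus_anti_mono ?_).trans hP
    rw [← hp]
    exact LTSeries.head_le p i.rev
  · have hlt : p j.rev < p i.rev := p.strictMono (Fin.rev_lt_rev.mpr hij)
    refine lt_of_le_of_ne (zeroLocus_anti_mono hlt.le) fun h => hlt.ne ?_
    ext1
    rw [← IsPrime.vanishingIdeal_zeroLocus (K := K) (p j.rev).asIdeal,
      ← IsPrime.vanishingIdeal_zeroLocus (K := K) (p i.rev).asIdeal]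
    exact congrArg (vanishingIdeal K) h.symm

lemma vanishingIdeal_singleton_le {K : Type*} [Field K] {n : ℕ}
    {P : Ideal (MvPolynomial (Fin n) K)} {a : Fin n → K} (ha : ∀ i, X i - C (a i) ∈ P) :
    vanishingIdeal K {a} ≤ P := by
  have hquot : Ideal.Quotient.mkₐ K P = (Algebra.ofId K _).comp (aeval a) := by
    refine MvPolynomial.algHom_ext fun i => ?_
    rw [AlgHom.comp_apply, aeval_X]
    exact Ideal.Quotient.eq.mpr (ha i)
  intro p hp
  rw [← Ideal.Quotient.eq_zero_iff_mem, ← Ideal.Quotient.mkₐ_eq_mk K, hquot, AlgHom.comp_apply,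
    (mem_vanishingIdeal_singleton_iff a p).mp hp, map_zero]

lemma coheight_eq_zero_of_prod_mem {F K : Type*} [Field F] [Fintype F] [Field K] [IsAlgClosed K]
    [Algebra F K] {n : ℕ} (P : PrimeSpectrum (MvPolynomial (Fin n) K))
    (hP : ∀ i, ∏ a : F, (X i - C (algebraMap F K a)) ∈ P.asIdeal) : Order.coheight P = 0 := by
  choose a ha using fun i => (P.2.prod_mem_iff).mp (hP i)
  rw [Order.coheight_eq_zero, PrimeSpectrum.isMax_iff]
  have hle := vanishingIdeal_singleton_le (a := fun i => algebraMap F K (a i)) fun i => (ha i).2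
  have hmax : (vanishingIdeal K {fun i => algebraMap F K (a i)}).IsMaximal :=
    isMaximal_iff_eq_vanishingIdeal_singleton.mpr ⟨_, rfl⟩
  rwa [← hmax.eq_of_le P.2.ne_top hle]

/-- The number of `F`-points of a variety of dimension at most `v` cut out by polynomials of degree
at most `d` is at most `d ^ (n - v) * |F| ^ v`. -/
theorem card_filter_eval_eq_zero_le {F K : Type*} [Field F] [Fintype F] [DecidableEq F] [Field K]
    [IsAlgClosed K] [Algebra F K] {n d v : ℕ} (S : Finset (MvPolynomial (Fin n) F))
    (hdeg : ∀ p ∈ S, p.totalDegree ≤ d)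
    (hv : ∀ P : PrimeSpectrum (MvPolynomial (Fin n) K),
      (∀ p ∈ S, map (algebraMap F K) p ∈ P.asIdeal) → Order.coheight P ≤ v) :
    (Finset.univ.filter fun x : Fin n → F => ∀ p ∈ S, eval x p = 0).card ≤
      d ^ (n - v) * Fintype.card F ^ (n - (n - v)) := by
  classical
  have : Infinite K := IsAlgClosed.instInfinite
  set W : ℕ → Submodule K (MvPolynomial (Fin n) K) := fun i =>
    if i < n - v then Submodule.span K (map (algebraMap F K) '' S)
    else Submodule.span K (Set.range fun i => ∏ a : F, (X i - C (algebraMap F K a))) with hW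
  set D : ℕ → ℕ := fun i => if i < n - v then d else Fintype.card F with hD
  have hWD : ∀ i, W i ≤ restrictTotalDegree (Fin n) K (D i) := by
    intro i
    simp only [hW, hD]
    split_ifs
    · rw [Submodule.span_le]
      rintro _ ⟨p, hp, rfl⟩
      exact (mem_restrictTotalDegree _ _ _).mpr ((Finset.sup_mono (support_map_subset _ _)).trans (hdeg p hp))
    · rw [Submodule.span_le]
      rintro _ ⟨j, rfl⟩
      refine (mem_restrictTotalDegree _ _ _).mpr ((totalDegree_finsetProd _ _).trans ?_)
      refine (Finset.sum_le_card_nsmul _ _ 1 fun a _ => ?_).trans (by simp)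
      exact (totalDegree_sub_C_le _ _).trans (totalDegree_X _).le
  obtain ⟨f, hfW, hf⟩ := exists_forall_mem_forall_coheight_le (W := W)
    (coheight_mvPolynomial_le (K := K) (n := n)) (fun i hi P hP => by
      simp only [hW] at hP
      split_ifs at hP with h
      · refine (hv P fun p hp => hP _ (Submodule.subset_span ⟨p, hp, rfl⟩)).trans ?_
        exact_mod_cast (by omega : v ≤ n - i - 1)
      · rw [coheight_eq_zero_of_prod_mem (F := F) P
          fun j => hP _ (Submodule.subset_span ⟨j, rfl⟩)]
        exact zero_le) le_rfl
  rw [Nat.sub_self, Nat.cast_zero] at hf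
  have hpoint : ∀ x : Fin n → F, (∀ p ∈ S, eval x p = 0) → ∀ i,
      f i ∈ vanishingIdeal K {fun i => algebraMap F K (x i)} := by
    intro x hx i
    suffices h : W i ≤ (vanishingIdeal K {fun i => algebraMap F K (x i)}).restrictScalars K from
      h (hfW i)
    simp only [hW]
    split_ifs
    · rw [Submodule.span_le]
      rintro _ ⟨p, hp, rfl⟩
      refine (mem_vanishingIdeal_singleton_iff _ _).mpr ?_
      rw [aeval_map_algebraMap]
      have := aeval_algebraMap_apply K x p
      rw [aeval_eq_eval, hx p hp, map_zero] at this
      exact this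
    · rw [Submodule.span_le]
      rintro _ ⟨j, rfl⟩
      refine (mem_vanishingIdeal_singleton_iff _ _).mpr ?_
      rw [map_prod]
      exact Finset.prod_eq_zero (Finset.mem_univ (x j)) (by simp)
  have hbezout := card_le_prod_totalDegree
    (ι := Finset.univ.filter fun x : Fin n → F => ∀ p ∈ S, eval x p = 0)
    (p := fun x i => algebraMap F K (x.1 i)) (f := fun i : Fin n => f i) (w := fun i => D i)
    (fun x y h => Subtype.ext (funext fun i => (algebraMap F K).injective (congrFun h i)))
    (fun i => (mem_restrictTotalDegree _ _ _).mp (hWD i (hfW i))) (fun x => by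
      have hx := hpoint x.1 (Finset.mem_filter.mp x.2).2
      refine ⟨⟨inferInstance, Ideal.span_le.mpr ?_⟩, fun Q ⟨hQ, hfQ⟩ hle => ?_⟩
      · rintro _ ⟨i, rfl⟩
        exact hx i
      · have h0 := hf ⟨Q, hQ⟩ fun i hi => hfQ (Ideal.subset_span ⟨⟨i, hi⟩, rfl⟩)
        have hmax := PrimeSpectrum.isMax_iff.mp (Order.coheight_eq_zero.mp (nonpos_iff_eq_zero.mp h0))
        exact (hmax.eq_of_le (Ideal.IsPrime.ne_top inferInstance) hle).ge)
  rw [Fintype.card_coe, Fin.prod_univ_eq_prod_range D n] at hbezout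
  refine hbezout.trans_eq ?_
  simp only [hD]
  rw [Finset.prod_ite, Finset.prod_const, Finset.prod_const]
  congr 2
  · rw [show (Finset.range n).filter (fun i => i < n - v) = Finset.range (n - v) by
      ext i; simp; omega, Finset.card_range]
  · rw [show (Finset.range n).filter (fun i => ¬ i < n - v) = Finset.Ico (n - v) n by
      ext i; simp; omega, Nat.card_Ico]

end

/-- Variety Schwarz–Zippel (Cohen–Moshkovitz): if `V ⊆ 𝔽̄^n` is a variety defined over a finite
field `F`, cut out by polynomials of degree at most `d`, then
`|V(F)|/|F|^n ≤ (d/|F|)^{codim V}`. -/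
theorem variety_schwarz_zippel (F : Type*) [Field F] [Fintype F] [DecidableEq F] (n d : ℕ)
    (S : Finset (MvPolynomial (Fin n) F)) (hdeg : ∀ p ∈ S, p.totalDegree ≤ d)
    (V : Set (Fin n → AlgebraicClosure F))
    (hV : V = {x | ∀ p ∈ S,
      MvPolynomial.eval x (MvPolynomial.map (algebraMap F (AlgebraicClosure F)) p) = 0}) :
    ((Finset.univ.filter (fun x : Fin n → F => ∀ p ∈ S, MvPolynomial.eval x p = 0)).card : ℝ) /
        (Fintype.card F : ℝ) ^ n ≤
      ((d : ℝ) / (Fintype.card F : ℝ)) ^ (n - varDim V) := by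
  have hcard := card_filter_eval_eq_zero_le (K := AlgebraicClosure F) (v := varDim V) S hdeg
    fun P hP => coheight_le_varDim P (by
      rw [hV]
      intro x hx p hp
      exact hx _ (hP p hp))
  have hq : (0 : ℝ) < Fintype.card F := by exact_mod_cast Fintype.card_pos
  rw [div_pow, div_le_div_iff₀ (by positivity) (by positivity)]
  set r := n - varDim V
  calc _ ≤ (d : ℝ) ^ r * (Fintype.card F : ℝ) ^ (n - r) * (Fintype.card F : ℝ) ^ r := by
        gcongr
        exact_mod_cast hcard
    _ = (d : ℝ) ^ r * (Fintype.card F : ℝ) ^ n := by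
        rw [mul_assoc, ← pow_add, Nat.sub_add_cancel (Nat.sub_le _ _)]
end

section
/- For any 3-tensor T over a perfect field F, the slice rank of T is at most three times the geometric rank of T: SR(T) ≤ 3·GR(T). -/
open scoped BigOperators

/-- The slice rank of a 3-tensor given by its coefficient array: the minimal number of summands
of the form (linear form in one variable) · (bilinear form in the other two). -/
noncomputable def sliceRank3 {F : Type*} [Field F] {n₁ n₂ n₃ : ℕ}
    (M : Fin n₁ → Fin n₂ → Fin n₃ → F) : ℕ :=
  sInf {r | ∃ c : Fin r → (Fin n₁ → Fin n₂ → Fin n₃ → F),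
    (∀ t, (∃ (f : Fin n₁ → F) (g : Fin n₂ → Fin n₃ → F), ∀ i j k, c t i j k = f i * g j k) ∨
          (∃ (f : Fin n₂ → F) (g : Fin n₁ → Fin n₃ → F), ∀ i j k, c t i j k = f j * g i k) ∨
          (∃ (f : Fin n₃ → F) (g : Fin n₁ → Fin n₂ → F), ∀ i j k, c t i j k = f k * g i j)) ∧
    ∀ i j k, M i j k = ∑ t, c t i j k}

theorem length_le_of_strictMono_primes {K A : Type*} [Field K] [CommRing A] [Algebra K A]
    {s d : ℕ} (g : MvPolynomial (Fin s) K →ₐ[K] A) (hg : g.IsIntegral)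
    (Q : Fin (d + 1) → Ideal A) (hQ : ∀ i, (Q i).IsPrime) (hmono : StrictMono Q) : d ≤ s := by
  algebraize [g.toRingHom]
  have hInt : Algebra.IsIntegral (MvPolynomial (Fin s) K) A := ⟨hg⟩
  let C : Fin (d + 1) → PrimeSpectrum (MvPolynomial (Fin s) K) := fun i =>
    ⟨(Q i).comap (algebraMap _ A), (hQ i).comap _⟩
  have hC : StrictMono C := by
    intro i j hij
    have := hQ i
    exact Ideal.IsIntegral.comap_lt_comap (hmono hij)
  have h := Order.LTSeries.length_le_krullDim (LTSeries.mk d C hC)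
  have h2 : ringKrullDim (MvPolynomial (Fin s) K) = s := by simp
  have h3 : ((d : ℕ) : WithBot ℕ∞) ≤ s := h2 ▸ h
  exact_mod_cast h3

open scoped IntermediateField.algebraAdjoinAdjoin in
theorem exists_linearIndependent_derivation_of_isSeparable {K L ι : Type*} [Field K] [Field L]
    [Algebra K L] {v : ι → L} (hv : AlgebraicIndependent K v)
    [Algebra.IsSeparable (IntermediateField.adjoin K (Set.range v)) L] :
    ∃ D : ι → Derivation K L L, LinearIndependent L D := by
  classical
  let S := Algebra.adjoin K (Set.range v)
  let E := IntermediateField.adjoin K (Set.range v)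
  let R := MvPolynomial ι K
  let _ : Algebra R S := hv.aevalEquiv.toAlgHom.toAlgebra
  let _ : Algebra R L := (MvPolynomial.aeval v).toAlgebra
  have : IsScalarTower K R S := IsScalarTower.of_algebraMap_eq fun x =>
    (hv.aevalEquiv.commutes x).symm
  have : IsScalarTower K R L := IsScalarTower.of_algebraMap_eq fun x =>
    ((MvPolynomial.aeval v).commutes x).symm
  have : IsScalarTower R S L := IsScalarTower.of_algebraMap_eq fun x =>
    (hv.algebraMap_aevalEquiv x).symm
  have : Algebra.FormallyEtale R S :=
    .of_equiv (AlgEquiv.ofRingEquiv (f := hv.aevalEquiv.toRingEquiv) fun _ => rfl)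
  have : Algebra.FormallyEtale S E := .of_isLocalization (nonZeroDivisors S)
  have : Algebra.FormallyEtale E L := .of_isSeparable E L
  have : Algebra.FormallyEtale S L := .comp S E L
  have : Algebra.FormallyEtale R L := .comp R S L
  let B := ((KaehlerDifferential.mvPolynomialBasis K ι).baseChange L).map
    (KaehlerDifferential.tensorKaehlerEquivOfFormallyEtale K R L)
  refine ⟨fun i => KaehlerDifferential.linearMapEquivDerivation K L (B.coord i), ?_⟩
  exact B.linearIndependent_coord.map' _ (LinearEquiv.ker _)

theorem exists_linearIndependent_derivation {K L : Type*} [Field K] [PerfectField K] [Field L]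
    [Algebra K L] [Algebra.EssFiniteType K L] {s : ℕ} {y : Fin s → L}
    (hy : AlgebraicIndependent K y) :
    ∃ D : Fin s → Derivation K L L, LinearIndependent L D := by
  obtain ⟨t, ht, hsep⟩ := exists_isTranscendenceBasis_and_isSeparable_of_perfectField K L
  have : Algebra.IsSeparable (IntermediateField.adjoin K (Set.range ((↑) : t → L))) L := by
    convert! hsep <;> simp
  obtain ⟨D, hD⟩ := exists_linearIndependent_derivation_of_isSeparable ht.1
  have h1 := hy.lift_cardinalMk_le_trdeg
  rw [← ht.cardinalMk_eq_trdeg] at h1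
  have h2 : Fintype.card (Fin s) ≤ Fintype.card t := by
    simpa using h1
  obtain ⟨f⟩ := Function.Embedding.nonempty_of_card_le h2
  exact ⟨D ∘ f, hD.comp _ f.injective⟩


/-- Evaluation at the coordinates `x`, as a linear map on derivations. -/
def derivationEval {K L : Type*} [Field K] [Field L] [Algebra K L] {n : ℕ} (x : Fin n → L) :
    Derivation K L L →ₗ[L] (Fin n → L) where
  toFun E i := E (x i)
  map_add' _ _ := rfl
  map_smul' _ _ := rfl

/-- A chain of `d + 1` primes yields a point over an extension field, with `d` independent tangent
vectors coming from derivations. -/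
theorem exists_generic_point.{u} {K : Type u} [Field K] [PerfectField K] {n d : ℕ}
    (Q : Fin (d + 1) → Ideal (MvPolynomial (Fin n) K)) (hQ : ∀ i, (Q i).IsPrime)
    (hmono : StrictMono Q) :
    ∃ (L : Type u) (_ : Field L) (_ : Algebra K L) (x : Fin n → L),
      (∀ p ∈ Q 0, MvPolynomial.aeval x p = 0) ∧
      ∃ D : Fin d → Derivation K L L, LinearIndependent L (fun t i => D t (x i)) := by
  have := hQ 0
  let A := MvPolynomial (Fin n) K ⧸ Q 0
  let L := FractionRing A
  have hcomap : ∀ i, ((Q i).map (Ideal.Quotient.mk (Q 0))).comap (Ideal.Quotient.mk (Q 0)) =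
      Q i := fun i => Ideal.comap_map_quotientMk _ _ |>.trans
        (sup_eq_right.mpr (hmono.monotone (Fin.zero_le i)))
  obtain ⟨s, g, hinj, hInt⟩ := exists_integral_inj_algHom_of_fg K A
  have hds : d ≤ s := by
    refine length_le_of_strictMono_primes g hInt
      (fun i => (Q i).map (Ideal.Quotient.mk (Q 0))) (fun i => ?_) (fun i j hij => ?_)
    · have := hQ i
      refine Ideal.map_isPrime_of_surjective Ideal.Quotient.mk_surjective ?_
      rw [Ideal.mk_ker]
      exact hmono.monotone (Fin.zero_le i)
    · refine lt_of_le_of_ne (Ideal.map_mono (hmono hij).le) fun h => (hmono hij).ne ?_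
      exact (hcomap i).symm.trans ((congrArg _ h).trans (hcomap j))
  let φ : A →ₐ[K] L := IsScalarTower.toAlgHom K A L
  have hφ : Function.Injective φ := IsFractionRing.injective A L
  have hy : AlgebraicIndependent K fun i : Fin s => φ (g (MvPolynomial.X i)) := by
    have : MvPolynomial.aeval (fun i : Fin s => φ (g (MvPolynomial.X i))) = φ.comp g := by
      ext; simp
    rw [AlgebraicIndependent, this]
    exact hφ.comp hinj
  have : Algebra.EssFiniteType A L := .of_isLocalization L (nonZeroDivisors A)
  have : Algebra.EssFiniteType K L := .comp K A L
  obtain ⟨D, hD⟩ := exists_linearIndependent_derivation hy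
  let x : Fin n → L := fun i => φ (Ideal.Quotient.mk (Q 0) (MvPolynomial.X i))
  have hx : MvPolynomial.aeval x = φ.comp (Ideal.Quotient.mkₐ K (Q 0)) := by
    ext; simp only [MvPolynomial.aeval_X]; rfl
  refine ⟨L, inferInstance, inferInstance, x, fun p hp => ?_, D ∘ Fin.castLE hds, ?_⟩
  · rw [hx, AlgHom.comp_apply, Ideal.Quotient.mkₐ_eq_mk, Ideal.Quotient.eq_zero_iff_mem.mpr hp,
      map_zero]
  · refine (hD.comp _ (Fin.castLE_injective hds)).map' (derivationEval x) ?_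
    rw [LinearMap.ker_eq_bot']
    intro E hE
    have hE' : ∀ a : A, E (algebraMap A L a) = 0 := by
      intro a
      obtain ⟨p, rfl⟩ := Ideal.Quotient.mk_surjective a
      have h1 : algebraMap A L (Ideal.Quotient.mk (Q 0) p) = MvPolynomial.aeval x p := by
        rw [hx]; rfl
      rw [h1]
      have hmem : MvPolynomial.aeval x p ∈ Algebra.adjoin K (Set.range x) := by
        rw [Algebra.adjoin_range_eq_range_aeval]
        exact ⟨p, rfl⟩
      have h2 : Set.EqOn E (0 : Derivation K L L) (Set.range x) := by
        rintro _ ⟨i, rfl⟩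
        exact congrFun hE i
      exact Derivation.eqOn_adjoin h2 hmem
    ext z
    obtain ⟨a, b, hb, rfl⟩ := IsFractionRing.div_surjective (A := A) z
    have hb0 : algebraMap A L b ≠ 0 := by
      simpa using nonZeroDivisors.ne_zero hb
    rw [Derivation.leibniz_div]
    simp [hE']

theorem exists_generic_point_of_varDim.{u} {K : Type u} [Field K] [PerfectField K] {n : ℕ}
    {V : Set (Fin n → K)} (hV : varDim V ≠ 0) :
    ∃ (L : Type u) (_ : Field L) (_ : Algebra K L) (x : Fin n → L),
      (∀ p : MvPolynomial (Fin n) K, (∀ v ∈ V, MvPolynomial.eval v p = 0) →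
        MvPolynomial.aeval x p = 0) ∧
      ∃ D : Fin (varDim V) → Derivation K L L, LinearIndependent L (fun t i => D t (x i)) := by
  have hmem : varDim V ∈ {k | ∃ C : Fin (k + 1) → Set (Fin n → K),
      (∀ i, IsIrreducibleSubvariety (C i)) ∧ (∀ i, C i ⊆ V) ∧ StrictMono C} := by
    refine Nat.sSup_mem ?_ ?_
    · by_contra h
      rw [Set.not_nonempty_iff_eq_empty] at h
      exact hV (by rw [varDim, h, csSup_empty]; rfl)
    · by_contra h
      exact hV (csSup_of_not_bddAbove h |>.trans (by simp))
  obtain ⟨C, hirr, hCV, hmono⟩ := hmem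
  have hI : ∀ i, MvPolynomial.zeroLocus K (MvPolynomial.vanishingIdeal K (C i)) = C i := by
    intro i
    obtain ⟨S, hS⟩ := (hirr i).1
    refine subset_antisymm (fun v hv => ?_) (MvPolynomial.zeroLocus_vanishingIdeal_le _)
    rw [hS]
    intro p hp
    have := hv p (fun w hw => by rw [hS] at hw; simpa using hw p hp)
    simpa using this
  let Q : Fin (varDim V + 1) → Ideal (MvPolynomial (Fin n) K) :=
    fun i => MvPolynomial.vanishingIdeal K (C i.rev)
  have hQmono : StrictMono Q := by
    intro i j hij
    have hlt := hmono (Fin.rev_lt_rev.mpr hij)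
    refine lt_of_le_of_ne (MvPolynomial.vanishingIdeal_anti_mono hlt.le) fun h => hlt.ne ?_
    rw [← hI i.rev, ← hI j.rev]
    exact congrArg _ h.symm
  have hQ : ∀ i, (Q i).IsPrime := by
    intro i
    obtain ⟨-, ⟨v, hv⟩, hcov⟩ := hirr i.rev
    refine ⟨fun h => ?_, fun {p q} hpq => ?_⟩
    · have h1 : (1 : MvPolynomial (Fin n) K) ∈ Q i := h ▸ Submodule.mem_top
      simpa using h1 v hv
    · have key : ∀ r : MvPolynomial (Fin n) K,
          IsSubvariety {x : Fin n → K | MvPolynomial.eval x r = 0} :=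
        fun r => ⟨{r}, by simp⟩
      refine (hcov _ _ (key p) (key q) fun w hw => ?_).imp (fun h w hw => ?_) (fun h w hw => ?_)
      · simpa using hpq w hw
      · simpa using h hw
      · simpa using h hw
  obtain ⟨L, _, _, x, hx, D, hD⟩ := exists_generic_point Q hQ hQmono
  exact ⟨L, _, _, x, fun p hp => hx p fun v hv => by simpa using hp v (hCV _ hv), D, hD⟩

/-- The trilinear form with coefficient array `M`. -/
noncomputable def triForm {R : Type*} [CommRing R] {n₁ n₂ n₃ : ℕ}
    (M : Fin n₁ → Fin n₂ → Fin n₃ → R) :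
    (Fin n₁ → R) →ₗ[R] (Fin n₂ → R) →ₗ[R] (Fin n₃ → R) →ₗ[R] R :=
  ∑ i, ∑ j, ∑ k, M i j k • (LinearMap.proj i : (Fin n₁ → R) →ₗ[R] R).smulRight
    ((LinearMap.proj j : (Fin n₂ → R) →ₗ[R] R).smulRight
      (LinearMap.proj k : (Fin n₃ → R) →ₗ[R] R))

theorem triForm_apply {R : Type*} [CommRing R] {n₁ n₂ n₃ : ℕ}
    (M : Fin n₁ → Fin n₂ → Fin n₃ → R) (u : Fin n₁ → R) (v : Fin n₂ → R) (w : Fin n₃ → R) :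
    triForm M u v w = ∑ i, ∑ j, ∑ k, M i j k * u i * v j * w k := by
  simp [triForm, LinearMap.sum_apply, mul_assoc]

/-- A ring homomorphism commutes with evaluation of a trilinear form. -/
theorem map_triForm {R S : Type*} [CommRing R] [CommRing S] (f : R →+* S) {n₁ n₂ n₃ : ℕ}
    (M : Fin n₁ → Fin n₂ → Fin n₃ → R) (u : Fin n₁ → R) (v : Fin n₂ → R) (w : Fin n₃ → R) :
    f (triForm M u v w) =
      triForm (fun i j k => f (M i j k)) (fun i => f (u i)) (fun j => f (v j))
        (fun k => f (w k)) := by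
  simp [triForm_apply]

/-- Differentiating the equations `T(u, v, ·) = 0`. -/
theorem derivation_triForm {K L : Type*} [Field K] [Field L] [Algebra K L] {n₁ n₂ n₃ : ℕ}
    (M : Fin n₁ → Fin n₂ → Fin n₃ → K) (E : Derivation K L L)
    (u : Fin n₁ → L) (v : Fin n₂ → L)
    (h : ∀ w, triForm (fun i j k => algebraMap K L (M i j k)) u v w = 0) (w : Fin n₃ → L) :
    triForm (fun i j k => algebraMap K L (M i j k)) (fun i => E (u i)) v w +
      triForm (fun i j k => algebraMap K L (M i j k)) u (fun j => E (v j)) w = 0 := by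
  have h1 : E (triForm (fun i j k => algebraMap K L (M i j k)) u v w) = 0 := by rw [h, map_zero]
  have h2 := h (fun k => E (w k))
  simp only [triForm_apply, map_sum, Derivation.leibniz, Derivation.map_algebraMap,
    smul_eq_mul] at h1 h2 ⊢
  rw [← sub_eq_zero.mpr (h1.trans h2.symm)]
  simp only [← Finset.sum_add_distrib, ← Finset.sum_sub_distrib]
  refine Finset.sum_congr rfl fun i _ => Finset.sum_congr rfl fun j _ =>
    Finset.sum_congr rfl fun k _ => ?_
  ring

/-- Tangent vectors at a point with `T(u, v, ·) = 0` yield a zero block of `T`. -/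
theorem exists_zero_block_of_derivations {K L : Type*} [Field K] [Field L] [Algebra K L]
    {n₁ n₂ n₃ d : ℕ} (M : Fin n₁ → Fin n₂ → Fin n₃ → K) (x : Fin (n₁ + n₂) → L)
    (hx : ∀ w, triForm (fun i j k => algebraMap K L (M i j k))
      (fun i => x (Fin.castAdd n₂ i)) (fun j => x (Fin.natAdd n₁ j)) w = 0)
    (D : Fin d → Derivation K L L) (hD : LinearIndependent L (fun t i => D t (x i))) :
    ∃ (U₁ : Submodule L (Fin n₁ → L)) (U₂ : Submodule L (Fin n₂ → L))
      (U₃ : Submodule L (Fin n₃ → L)),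
      (∀ u ∈ U₁, ∀ v ∈ U₂, ∀ w ∈ U₃,
        triForm (fun i j k => algebraMap K L (M i j k)) u v w = 0) ∧
      d ≤ Module.finrank L U₁ + Module.finrank L U₂ ∧
      Module.finrank L U₂ + n₃ = Module.finrank L U₃ + n₂ := by
  set T := triForm (fun i j k => algebraMap K L (M i j k)) with hT
  set ξ : Fin n₁ → L := fun i => x (Fin.castAdd n₂ i) with hξ
  let N : Matrix (Fin n₂) (Fin n₃) L := fun j k => ∑ i, algebraMap K L (M i j k) * ξ i
  have hN : ∀ v w, T ξ v w = v ⬝ᵥ (N.mulVec w) := by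
    intro v w
    simp only [hT, triForm_apply, dotProduct, Matrix.mulVec, N, Finset.mul_sum, Finset.sum_mul]
    rw [Finset.sum_comm]
    refine Finset.sum_congr rfl fun j _ => ?_
    rw [Finset.sum_comm]
    exact Finset.sum_congr rfl fun k _ => Finset.sum_congr rfl fun i _ => by ring
  let U₂ := LinearMap.ker N.transpose.mulVecLin
  let U₃ := LinearMap.ker N.mulVecLin
  have hU₂ : ∀ v, v ∈ U₂ ↔ ∀ w, T ξ v w = 0 := by
    intro v
    simp only [U₂, LinearMap.mem_ker, Matrix.mulVecLin_apply, hN, Matrix.dotProduct_mulVec,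
      Matrix.mulVec_transpose]
    exact (dotProduct_eq_zero_iff).symm
  have hU₃ : ∀ w ∈ U₃, ∀ v, T ξ v w = 0 := by
    intro w hw v
    have : N.mulVec w = 0 := hw
    rw [hN, this, dotProduct_zero]
  let W := (Submodule.span L (Set.range D)).map (derivationEval x)
  have hW : Module.finrank L W = d := by
    have : W = Submodule.span L (Set.range fun t i => D t (x i)) := by
      simp only [W, Submodule.map_span, ← Set.range_comp]; rfl
    rw [this, finrank_span_eq_card hD, Fintype.card_fin]
  let p₁ : (Fin (n₁ + n₂) → L) →ₗ[L] (Fin n₁ → L) := LinearMap.funLeft L L (Fin.castAdd n₂)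
  let p₂ : (Fin (n₁ + n₂) → L) →ₗ[L] (Fin n₂ → L) := LinearMap.funLeft L L (Fin.natAdd n₁)
  refine ⟨LinearMap.range (p₁.comp W.subtype), U₂, U₃, ?_, ?_, ?_⟩
  · rintro _ ⟨⟨_, E, -, rfl⟩, rfl⟩ v hv w hw
    have := derivation_triForm M E ξ v ((hU₂ v).mp hv) w
    rwa [← hT, hU₃ w hw, add_zero] at this
  · rw [← hW, ← LinearMap.finrank_range_add_finrank_ker (p₁.comp W.subtype)]
    refine Nat.add_le_add_left ?_ _
    have hmem : ∀ y : LinearMap.ker (p₁.comp W.subtype), p₂ y.1.1 ∈ U₂ := by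
      rintro ⟨⟨_, E, hE, rfl⟩, hy⟩
      rw [hU₂]
      intro w
      have h1 := derivation_triForm M E ξ _ hx w
      have h2 : (fun i => E (ξ i)) = 0 := hy
      rw [h2, map_zero, LinearMap.zero_apply, LinearMap.zero_apply, zero_add] at h1
      exact h1
    let q : LinearMap.ker (p₁.comp W.subtype) →ₗ[L] U₂ :=
      ((p₂.comp W.subtype).comp (LinearMap.ker (p₁.comp W.subtype)).subtype).codRestrict U₂ hmem
    refine LinearMap.finrank_le_finrank_of_injective (f := q) fun y z hyz => ?_
    have h1 : p₁ y.1.1 = p₁ z.1.1 := Eq.trans y.2 (Eq.symm z.2)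
    have h2 : p₂ y.1.1 = p₂ z.1.1 := congrArg Subtype.val hyz
    refine Subtype.ext (Subtype.ext (funext fun i => ?_))
    induction i using Fin.addCases with
    | left i => exact congrFun h1 i
    | right i => exact congrFun h2 i
  · have h2 := LinearMap.finrank_range_add_finrank_ker N.transpose.mulVecLin
    have h3 := LinearMap.finrank_range_add_finrank_ker N.mulVecLin
    have h4 : N.transpose.rank = N.rank := Matrix.rank_transpose N
    simp only [Matrix.rank] at h4
    simp only [Module.finrank_fin_fun] at h2 h3
    simp only [U₂, U₃]
    omega

theorem exists_linearIndependent_extending {L : Type*} [Field L] {n : ℕ}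
    (U : Submodule L (Fin n → L)) :
    ∃ e : Fin n → (Fin n → L), LinearIndependent L e ∧
      ∃ S : Finset (Fin n), S.card = Module.finrank L U ∧ ∀ i ∈ S, e i ∈ U := by
  obtain ⟨U', hU'⟩ := U.exists_isCompl
  let b := ((Module.finBasis L U).prod (Module.finBasis L U')).map
    (Submodule.prodEquivOfIsCompl U U' hU')
  have hcard : Fintype.card (Fin (Module.finrank L U) ⊕ Fin (Module.finrank L U')) =
      Fintype.card (Fin n) := by
    rw [← Module.finrank_eq_card_basis b]; simp
  let f := Fintype.equivOfCardEq hcard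
  refine ⟨b ∘ f.symm, b.linearIndependent.comp _ f.symm.injective,
    Finset.univ.map (Function.Embedding.inl.trans f.toEmbedding), by simp, ?_⟩
  intro i hi
  simp only [Finset.mem_map, Finset.mem_univ, true_and] at hi
  obtain ⟨a, rfl⟩ := hi
  simp [b]

theorem nonempty_algHom_of_finiteType {K A : Type*} [Field K] [IsAlgClosed K] [CommRing A]
    [Nontrivial A] [Algebra K A] [Algebra.FiniteType K A] : Nonempty (A →ₐ[K] K) := by
  obtain ⟨m, hm⟩ := Ideal.exists_maximal A
  let _ : Field (A ⧸ m) := Ideal.Quotient.field m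
  have : Module.Finite K (A ⧸ m) := finite_of_finite_type_of_isJacobsonRing K (A ⧸ m)
  have : Algebra.IsAlgebraic K (A ⧸ m) := Algebra.IsAlgebraic.of_finite K (A ⧸ m)
  exact ⟨(IsAlgClosed.lift : A ⧸ m →ₐ[K] K).comp (Ideal.Quotient.mkₐ K m)⟩

theorem linearIndependent_iff_isUnit_det {R : Type*} [Field R] {n : ℕ}
    (e : Fin n → (Fin n → R)) : LinearIndependent R e ↔ IsUnit (Matrix.of e).det := by
  rw [← Matrix.isUnit_iff_isUnit_det, ← Matrix.linearIndependent_rows_iff_isUnit]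
  rfl

theorem linearIndependent_of_algHom {K L : Type*} [Field K] [Field L] [Algebra K L] {n : ℕ}
    {e : Fin n → (Fin n → L)} (he : LinearIndependent L e) {A : Subalgebra K L} (φ : A →ₐ[K] K)
    (hA : ∀ i j, e i j ∈ A) (hdet : (Matrix.of e).det⁻¹ ∈ A) :
    LinearIndependent K (fun i j => φ ⟨e i j, hA i j⟩) := by
  rw [linearIndependent_iff_isUnit_det] at he ⊢
  let E : Matrix (Fin n) (Fin n) A := Matrix.of fun i j => ⟨e i j, hA i j⟩
  have hE : ((E.det : A) : L) = (Matrix.of e).det := by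
    change A.val E.det = _
    rw [AlgHom.map_det]
    rfl
  have h1 : E.det * ⟨_, hdet⟩ = 1 := Subtype.ext (by
    rw [Subalgebra.coe_mul, hE]
    exact mul_inv_cancel₀ he.ne_zero)
  have h2 : IsUnit (φ E.det) := (IsUnit.of_mul_eq_one _ h1).map φ
  rw [AlgHom.map_det] at h2
  exact h2

/-- A zero block of a tensor over an algebraically closed field `K` which exists over some field
extension already exists over `K`. -/
theorem exists_zero_block_of_extension {K L : Type*} [Field K] [IsAlgClosed K] [Field L]
    [Algebra K L] {n₁ n₂ n₃ : ℕ} (M : Fin n₁ → Fin n₂ → Fin n₃ → K)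
    {e₁ : Fin n₁ → (Fin n₁ → L)} {e₂ : Fin n₂ → (Fin n₂ → L)} {e₃ : Fin n₃ → (Fin n₃ → L)}
    (h₁ : LinearIndependent L e₁) (h₂ : LinearIndependent L e₂) (h₃ : LinearIndependent L e₃)
    (S₁ : Finset (Fin n₁)) (S₂ : Finset (Fin n₂)) (S₃ : Finset (Fin n₃))
    (hzero : ∀ i ∈ S₁, ∀ j ∈ S₂, ∀ k ∈ S₃,
      triForm (fun i j k => algebraMap K L (M i j k)) (e₁ i) (e₂ j) (e₃ k) = 0) :
    ∃ (f₁ : Fin n₁ → (Fin n₁ → K)) (f₂ : Fin n₂ → (Fin n₂ → K)) (f₃ : Fin n₃ → (Fin n₃ → K)),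
      LinearIndependent K f₁ ∧ LinearIndependent K f₂ ∧ LinearIndependent K f₃ ∧
      ∀ i ∈ S₁, ∀ j ∈ S₂, ∀ k ∈ S₃, triForm M (f₁ i) (f₂ j) (f₃ k) = 0 := by
  let Z : Set L := Set.range (fun p : Fin n₁ × Fin n₁ => e₁ p.1 p.2) ∪
    Set.range (fun p : Fin n₂ × Fin n₂ => e₂ p.1 p.2) ∪
    Set.range (fun p : Fin n₃ × Fin n₃ => e₃ p.1 p.2) ∪
    {(Matrix.of e₁).det⁻¹, (Matrix.of e₂).det⁻¹, (Matrix.of e₃).det⁻¹}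
  have hZ : Z.Finite := by
    refine Set.Finite.union (Set.Finite.union (Set.Finite.union ?_ ?_) ?_) ?_
    · exact Set.finite_range _
    · exact Set.finite_range _
    · exact Set.finite_range _
    · simp
  let A := Algebra.adjoin K Z
  have hZA : Z ⊆ A := Algebra.subset_adjoin
  have : Algebra.FiniteType K A := Algebra.FiniteType.adjoin_of_finite hZ
  obtain ⟨φ⟩ := nonempty_algHom_of_finiteType (K := K) (A := A)
  have m₁ : ∀ i j, e₁ i j ∈ A := fun i j => hZA (.inl (.inl (.inl ⟨(i, j), rfl⟩)))
  have m₂ : ∀ i j, e₂ i j ∈ A := fun i j => hZA (.inl (.inl (.inr ⟨(i, j), rfl⟩)))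
  have m₃ : ∀ i j, e₃ i j ∈ A := fun i j => hZA (.inl (.inr ⟨(i, j), rfl⟩))
  refine ⟨_, _, _,
    linearIndependent_of_algHom h₁ φ m₁ (hZA (.inr (by simp))),
    linearIndependent_of_algHom h₂ φ m₂ (hZA (.inr (by simp))),
    linearIndependent_of_algHom h₃ φ m₃ (hZA (.inr (by simp))), fun i hi j hj k hk => ?_⟩
  have h0 : triForm (fun i j k => algebraMap K A (M i j k)) (fun a => (⟨e₁ i a, m₁ i a⟩ : A))
      (fun a => (⟨e₂ j a, m₂ j a⟩ : A)) (fun a => (⟨e₃ k a, m₃ k a⟩ : A)) = 0 := by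
    refine Subtype.val_injective ?_
    have := map_triForm (A.val : A →+* L) (fun i j k => algebraMap K A (M i j k))
      (fun a => (⟨e₁ i a, m₁ i a⟩ : A)) (fun a => ⟨e₂ j a, m₂ j a⟩) (fun a => ⟨e₃ k a, m₃ k a⟩)
    exact this.trans (hzero i hi j hj k hk)
  have := congrArg (φ : A →+* K) h0
  rw [map_triForm, map_zero] at this
  simpa using this

/-- The span of the basis vectors whose weight is less than `s`. -/
def levelSpan {K ι V : Type*} [Field K] [AddCommGroup V] [Module K V] (b : ι → V) (x : ι → ℝ)
    (s : ℝ) : Submodule K V :=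
  Submodule.span K (b '' {i | x i < s})

theorem levelSpan_comp_equiv {K ι κ V : Type*} [Field K] [AddCommGroup V] [Module K V]
    (b : ι → V) (x : ι → ℝ) (π : κ ≃ ι) (s : ℝ) :
    levelSpan (K := K) (b ∘ π) (x ∘ π) s = levelSpan b x s := by
  have : {i | (x ∘ π) i < s} = π ⁻¹' {i | x i < s} := rfl
  rw [levelSpan, levelSpan, this, Set.image_comp, Set.image_preimage_eq _ π.surjective]

theorem mem_flag_iff {K V : Type*} [Field K] [AddCommGroup V] [Module K V] {n : ℕ}
    (b : Module.Basis (Fin n) K V) (k : ℕ) (v : V) :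
    v ∈ Submodule.span K (b '' {i | (i : ℕ) < k}) ↔ ∀ i : Fin n, k ≤ i → b.repr v i = 0 := by
  rw [b.mem_span_image]
  refine ⟨fun h i hi => ?_, fun h i hi => ?_⟩
  · by_contra hne
    exact absurd (h (Finsupp.mem_support_iff.mpr hne)) (by simpa using hi)
  · by_contra hne
    exact (Finsupp.mem_support_iff.mp hi) (h i (by simpa using hne))

theorem flag_mono {K V : Type*} [Field K] [AddCommGroup V] [Module K V] {n : ℕ}
    (b : Fin n → V) {k l : ℕ} (h : k ≤ l) :
    Submodule.span K (b '' {i | (i : ℕ) < k}) ≤ Submodule.span K (b '' {i | (i : ℕ) < l}) :=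
  Submodule.span_mono (Set.image_mono fun _ hi => lt_of_lt_of_le hi h)

/-- Vectors that enter a complete flag one at a time span its members. -/
theorem span_image_eq_flag {K V : Type*} [Field K] [AddCommGroup V] [Module K V] {n : ℕ}
    (b : Module.Basis (Fin n) K V) (f : Fin n → V)
    (hf : ∀ i : Fin n, f i ∈ Submodule.span K (b '' {j | (j : ℕ) < i + 1}))
    (hf' : ∀ i : Fin n, f i ∉ Submodule.span K (b '' {j | (j : ℕ) < i})) (k : ℕ) :
    Submodule.span K (f '' {i | (i : ℕ) < k}) = Submodule.span K (b '' {i | (i : ℕ) < k}) := by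
  induction k with
  | zero => simp
  | succ k ih =>
    by_cases hk : k < n
    · have hset : {i : Fin n | (i : ℕ) < k + 1} = insert ⟨k, hk⟩ {i : Fin n | (i : ℕ) < k} := by
        ext i
        simp only [Set.mem_ofPred_eq, Set.mem_insert_iff, Fin.ext_iff]
        omega
      have h1 := hf ⟨k, hk⟩
      have h2 := hf' ⟨k, hk⟩
      simp only [hset, Set.image_insert_eq] at h1 ⊢
      have h3 := mem_span_insert_exchange h1 h2
      rw [Submodule.span_insert, Submodule.span_insert] at *
      rw [ih]
      refine le_antisymm (sup_le ?_ le_sup_right) (sup_le ?_ le_sup_right) <;>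
        rwa [Submodule.span_singleton_le_iff_mem]
    · have hset : {i : Fin n | (i : ℕ) < k + 1} = {i : Fin n | (i : ℕ) < k} := by
        ext i
        simp only [Set.mem_ofPred_eq]
        omega
      rw [hset, ih]

/-- Two complete flags have a common adapted basis, in relative position given by a permutation. -/
theorem exists_common_adapted_basis {K V : Type*} [Field K] [AddCommGroup V] [Module K V] {n : ℕ}
    (b β : Module.Basis (Fin n) K V) :
    ∃ (e : Fin n → V) (σ : Fin n ≃ Fin n), ∀ k : ℕ,
      Submodule.span K (e '' {i | (i : ℕ) < k}) = Submodule.span K (b '' {i | (i : ℕ) < k}) ∧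
      Submodule.span K (e '' {i | (σ i : ℕ) < k}) =
        Submodule.span K (β '' {i | (i : ℕ) < k}) := by
  classical
  have hP : ∀ k : Fin n, ∃ m : ℕ, ∃ v, v ∈ Submodule.span K (b '' {i | (i : ℕ) < k + 1}) ∧
      v ∉ Submodule.span K (b '' {i | (i : ℕ) < k}) ∧
      v ∈ Submodule.span K (β '' {i | (i : ℕ) < m}) := by
    refine fun k => ⟨n, b k, Submodule.subset_span ⟨k, by simp, rfl⟩, ?_, ?_⟩
    · rw [mem_flag_iff]
      intro h
      simpa using h k le_rfl
    · rw [mem_flag_iff]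
      exact fun i hi => absurd i.2 (by omega)
  obtain ⟨m, hm⟩ : ∃ m : Fin n → ℕ, ∀ k, m k = Nat.find (hP k) := ⟨_, fun _ => rfl⟩
  choose e he using fun k => Nat.find_spec (hP k)
  have hmin : ∀ k, ∀ l < m k, ∀ v ∈ Submodule.span K (b '' {i | (i : ℕ) < k + 1}),
      v ∈ Submodule.span K (β '' {i | (i : ℕ) < l}) →
        v ∈ Submodule.span K (b '' {i | (i : ℕ) < k}) := by
    intro k l hl v hv hv'
    by_contra h
    exact Nat.find_min (hP k) (hl.trans_eq (hm k)) ⟨v, hv, h, hv'⟩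
  have hle : ∀ k, m k ≤ n := by
    refine fun k => (hm k).trans_le (Nat.find_min' (hP k) ⟨e k, (he k).1, (he k).2.1, ?_⟩)
    rw [mem_flag_iff]
    exact fun i hi => absurd i.2 (by omega)
  simp only [← hm] at he
  clear hm
  have hpos : ∀ k, 0 < m k := by
    intro k
    by_contra h
    have h0 : m k = 0 := by omega
    have h1 := (he k).2.2
    rw [h0] at h1
    have h2 : e k = 0 := by simpa using h1
    exact (he k).2.1 (h2 ▸ zero_mem _)
  let σ : Fin n → Fin n := fun k => ⟨m k - 1, by have := hpos k; have := hle k; omega⟩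
  have hσ : ∀ k, (σ k : ℕ) + 1 = m k := fun k => Nat.sub_add_cancel (hpos k)
  have hmem : ∀ k, e k ∈ Submodule.span K (β '' {i | (i : ℕ) < σ k + 1}) :=
    fun k => by rw [hσ]; exact (he k).2.2
  have hnmem : ∀ k, e k ∉ Submodule.span K (β '' {i | (i : ℕ) < σ k}) :=
    fun k h => (he k).2.1 (hmin k _ (by have := hσ k; omega) _ (he k).1 h)
  have hcoef : ∀ k, β.repr (e k) (σ k) ≠ 0 := by
    intro k h
    refine hnmem k ((mem_flag_iff β _ _).mpr fun i hi => ?_)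
    rcases hi.eq_or_lt with hi | hi
    · rwa [← Fin.ext hi]
    · exact (mem_flag_iff β _ _).mp (hmem k) i hi
  have hlt : ∀ k l : Fin n, k < l → σ k ≠ σ l := by
    intro k l hkl hs
    have hkl' : (k : ℕ) + 1 ≤ l := hkl
    have hek : e k ∈ Submodule.span K (b '' {i | (i : ℕ) < l}) :=
      flag_mono b hkl' (he k).1
    set c := β.repr (e l) (σ l) / β.repr (e k) (σ k) with hc
    have h1 : e l - c • e k ∈ Submodule.span K (β '' {i | (i : ℕ) < σ l}) := by
      rw [mem_flag_iff]
      intro i hi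
      rw [map_sub, map_smul, Finsupp.sub_apply, Finsupp.smul_apply, smul_eq_mul]
      rcases hi.eq_or_lt with hi | hi
      · rw [← Fin.ext hi, hc, ← hs, div_mul_cancel₀ _ (hcoef k), sub_self]
      · rw [(mem_flag_iff β _ _).mp (hmem l) i hi,
          (mem_flag_iff β _ _).mp (hmem k) i (by rw [hs]; exact hi), mul_zero, sub_zero]
    have h2 := hmin l _ (by have := hσ l; omega) _ (sub_mem (he l).1 (Submodule.smul_mem _ c
      (flag_mono b (Nat.le_succ l) hek))) h1
    exact (he l).2.1 ((Submodule.sub_mem_iff_left _ (Submodule.smul_mem _ c hek)).mp h2)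
  have hinj : Function.Injective σ := by
    intro k l h
    rcases lt_trichotomy k l with hkl | hkl | hkl
    · exact absurd h (hlt k l hkl)
    · exact hkl
    · exact absurd h.symm (hlt l k hkl)
  let σ' : Fin n ≃ Fin n := Equiv.ofBijective σ (Finite.injective_iff_bijective.mp hinj)
  refine ⟨e, σ', fun k => ⟨span_image_eq_flag b e (fun i => (he i).1) (fun i => (he i).2.1) k, ?_⟩⟩
  rw [← span_image_eq_flag β (e ∘ σ'.symm) (fun i => ?_) (fun i => ?_) k]
  · rw [Set.image_comp]
    congr 2
    ext i
    simp
  · have := hmem (σ'.symm i)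
    rwa [show σ (σ'.symm i) = i from σ'.apply_symm_apply i] at this
  · have := hnmem (σ'.symm i)
    rwa [show σ (σ'.symm i) = i from σ'.apply_symm_apply i] at this

theorem exists_setOf_lt_eq_of_monotone {n : ℕ} {x : Fin n → ℝ} (hx : Monotone x) (s : ℝ) :
    ∃ k : ℕ, {i | x i < s} = {i : Fin n | (i : ℕ) < k} := by
  classical
  have h : ∃ k : ℕ, ∀ i : Fin n, k ≤ i → s ≤ x i := ⟨n, fun i hi => absurd i.2 (by omega)⟩
  refine ⟨Nat.find h, Set.ext fun i => ⟨fun hi => ?_, fun hi => ?_⟩⟩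
  · by_contra hk
    exact absurd (Nat.find_spec h i (not_lt.mp hk)) (not_le.mpr hi)
  · have h1 := Nat.find_min h hi
    push Not at h1
    obtain ⟨j, hj, hjs⟩ := h1
    exact (hx hj).trans_lt hjs

/-- Two weighted bases have a common basis compatible with both filtrations. -/
theorem exists_common_basis {K V : Type*} [Field K] [AddCommGroup V] [Module K V] {n : ℕ}
    (b β : Module.Basis (Fin n) K V) (x x' : Fin n → ℝ) :
    ∃ (e : Module.Basis (Fin n) K V) (π π' : Fin n ≃ Fin n), ∀ s : ℝ,
      levelSpan (K := K) e (x ∘ π) s = levelSpan b x s ∧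
      levelSpan (K := K) e (x' ∘ π') s = levelSpan β x' s := by
  let τ := Tuple.sort x
  let τ' := Tuple.sort x'
  have hτ : Monotone (x ∘ τ) := Tuple.monotone_sort x
  have hτ' : Monotone (x' ∘ τ') := Tuple.monotone_sort x'
  obtain ⟨e, σ, he⟩ := exists_common_adapted_basis (b.reindex τ.symm) (β.reindex τ'.symm)
  have hspan : ⊤ ≤ Submodule.span K (Set.range e) := by
    have h := (he n).1
    have huniv : {i : Fin n | (i : ℕ) < n} = Set.univ := by ext i; simp
    rw [huniv, Set.image_univ, Set.image_univ, Module.Basis.span_eq] at h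
    exact h.ge
  have hfin : Module.Finite K V := Module.Finite.of_basis b
  have hcard : Fintype.card (Fin n) = Module.finrank K V :=
    (Module.finrank_eq_card_basis b).symm
  refine ⟨basisOfTopLeSpanOfCardEqFinrank e hspan hcard, τ, σ.trans τ', fun s => ⟨?_, ?_⟩⟩
  · obtain ⟨k, hk⟩ := exists_setOf_lt_eq_of_monotone hτ s
    rw [← levelSpan_comp_equiv b x τ, levelSpan, levelSpan, hk,
      coe_basisOfTopLeSpanOfCardEqFinrank, (he k).1, Module.Basis.coe_reindex, Equiv.symm_symm]
  · obtain ⟨k, hk⟩ := exists_setOf_lt_eq_of_monotone hτ' s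
    have hk' : {i | (x' ∘ (σ.trans τ')) i < s} = {i | (σ i : ℕ) < k} :=
      congrArg (fun S => σ ⁻¹' S) hk
    rw [← levelSpan_comp_equiv β x' τ', levelSpan, levelSpan, hk, hk',
      coe_basisOfTopLeSpanOfCardEqFinrank, (he k).2, Module.Basis.coe_reindex, Equiv.symm_symm]

/-- The weights assign total weight at least one to every nonzero coefficient of `T`. -/
def IsFeasible {K V₁ V₂ V₃ ι₁ ι₂ ι₃ : Type*} [Field K] [AddCommGroup V₁] [Module K V₁]
    [AddCommGroup V₂] [Module K V₂] [AddCommGroup V₃] [Module K V₃]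
    (T : V₁ →ₗ[K] V₂ →ₗ[K] V₃ →ₗ[K] K) (b₁ : ι₁ → V₁) (b₂ : ι₂ → V₂) (b₃ : ι₃ → V₃)
    (x : (ι₁ → ℝ) × (ι₂ → ℝ) × (ι₃ → ℝ)) : Prop :=
  ∀ i j k, T (b₁ i) (b₂ j) (b₃ k) ≠ 0 → 1 ≤ x.1 i + x.2.1 j + x.2.2 k

theorem trilinear_eq_zero_of_mem_span {K V₁ V₂ V₃ : Type*} [Field K] [AddCommGroup V₁]
    [Module K V₁] [AddCommGroup V₂] [Module K V₂] [AddCommGroup V₃] [Module K V₃]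
    (T : V₁ →ₗ[K] V₂ →ₗ[K] V₃ →ₗ[K] K) {s₁ : Set V₁} {s₂ : Set V₂} {s₃ : Set V₃}
    (h : ∀ u ∈ s₁, ∀ v ∈ s₂, ∀ w ∈ s₃, T u v w = 0) {u : V₁} {v : V₂} {w : V₃}
    (hu : u ∈ Submodule.span K s₁) (hv : v ∈ Submodule.span K s₂)
    (hw : w ∈ Submodule.span K s₃) : T u v w = 0 := by
  induction hu using Submodule.span_induction with
  | zero => simp
  | add a b _ _ ha hb => simp [ha, hb]
  | smul c a _ ha => simp [ha]
  | mem u hu =>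
    induction hv using Submodule.span_induction with
    | zero => simp
    | add a b _ _ ha hb => simp [ha, hb]
    | smul c a _ ha => simp [ha]
    | mem v hv =>
      induction hw using Submodule.span_induction with
      | zero => simp
      | add a b _ _ ha hb => simp [ha, hb]
      | smul c a _ ha => simp [ha]
      | mem w hw => exact h u hu v hv w hw

/-- Feasibility depends only on the filtrations by level spans. -/
theorem isFeasible_iff {K V₁ V₂ V₃ ι₁ ι₂ ι₃ : Type*} [Field K] [AddCommGroup V₁] [Module K V₁]
    [AddCommGroup V₂] [Module K V₂] [AddCommGroup V₃] [Module K V₃]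
    (T : V₁ →ₗ[K] V₂ →ₗ[K] V₃ →ₗ[K] K) (b₁ : ι₁ → V₁) (b₂ : ι₂ → V₂) (b₃ : ι₃ → V₃)
    (x : (ι₁ → ℝ) × (ι₂ → ℝ) × (ι₃ → ℝ)) :
    IsFeasible T b₁ b₂ b₃ x ↔ ∀ s₁ s₂ s₃ : ℝ, s₁ + s₂ + s₃ ≤ 1 →
      ∀ u ∈ levelSpan (K := K) b₁ x.1 s₁, ∀ v ∈ levelSpan (K := K) b₂ x.2.1 s₂,
      ∀ w ∈ levelSpan (K := K) b₃ x.2.2 s₃, T u v w = 0 := by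
  constructor
  · intro h s₁ s₂ s₃ hs u hu v hv w hw
    refine trilinear_eq_zero_of_mem_span T ?_ hu hv hw
    rintro _ ⟨i, hi, rfl⟩ _ ⟨j, hj, rfl⟩ _ ⟨k, hk, rfl⟩
    by_contra hne
    have := h i j k hne
    simp only [Set.mem_ofPred_eq] at hi hj hk
    linarith
  · intro h i j k hne
    by_contra hlt
    set δ := (1 - (x.1 i + x.2.1 j + x.2.2 k)) / 3 with hδ
    have hδ0 : 0 < δ := by rw [hδ]; linarith
    refine hne (h (x.1 i + δ) (x.2.1 j + δ) (x.2.2 k + δ) (by rw [hδ]; linarith)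
      _ (Submodule.subset_span ⟨i, ?_, rfl⟩) _ (Submodule.subset_span ⟨j, ?_, rfl⟩)
      _ (Submodule.subset_span ⟨k, ?_, rfl⟩)) <;>
    simpa using hδ0

/-- A strictly convex perturbation of the total weight, counting the first factor twice. -/
noncomputable def weightCost {ι₁ ι₂ ι₃ : Type*} [Fintype ι₁] [Fintype ι₂] [Fintype ι₃] (ε : ℝ)
    (x : (ι₁ → ℝ) × (ι₂ → ℝ) × (ι₃ → ℝ)) : ℝ :=
  2 * ∑ i, (x.1 i + ε * x.1 i ^ 2) + ∑ j, (x.2.1 j + ε * x.2.1 j ^ 2) +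
    ∑ k, (x.2.2 k + ε * x.2.2 k ^ 2)

theorem weightCost_comp_equiv {ι₁ ι₂ ι₃ : Type*} [Fintype ι₁] [Fintype ι₂] [Fintype ι₃] (ε : ℝ)
    (x : (ι₁ → ℝ) × (ι₂ → ℝ) × (ι₃ → ℝ)) (π₁ : ι₁ ≃ ι₁) (π₂ : ι₂ ≃ ι₂) (π₃ : ι₃ ≃ ι₃) :
    weightCost ε (x.1 ∘ π₁, x.2.1 ∘ π₂, x.2.2 ∘ π₃) = weightCost ε x := by
  simp only [weightCost, Function.comp_apply]
  rw [Equiv.sum_comp π₁ (fun i => x.1 i + ε * x.1 i ^ 2),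
    Equiv.sum_comp π₂ (fun i => x.2.1 i + ε * x.2.1 i ^ 2),
    Equiv.sum_comp π₃ (fun i => x.2.2 i + ε * x.2.2 i ^ 2)]

theorem sum_midpoint_add_sum_sq {ι : Type*} [Fintype ι] (ε : ℝ) (a c : ι → ℝ) :
    ∑ i, ((1 / 2 : ℝ) * (a i + c i) + ε * ((1 / 2 : ℝ) * (a i + c i)) ^ 2) +
        ε / 4 * ∑ i, (a i - c i) ^ 2 =
      (∑ i, (a i + ε * a i ^ 2) + ∑ i, (c i + ε * c i ^ 2)) / 2 := by
  rw [Finset.mul_sum, ← Finset.sum_add_distrib, ← Finset.sum_add_distrib, Finset.sum_div]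
  exact Finset.sum_congr rfl fun i _ => by ring

/-- The parallelogram identity for `weightCost`. -/
theorem weightCost_midpoint {ι₁ ι₂ ι₃ : Type*} [Fintype ι₁] [Fintype ι₂] [Fintype ι₃] (ε : ℝ)
    (x y : (ι₁ → ℝ) × (ι₂ → ℝ) × (ι₃ → ℝ)) :
    weightCost ε ((1 / 2 : ℝ) • (x + y)) + ε / 4 * (2 * ∑ i, (x.1 i - y.1 i) ^ 2 +
      ∑ j, (x.2.1 j - y.2.1 j) ^ 2 + ∑ k, (x.2.2 k - y.2.2 k) ^ 2) =
      (weightCost ε x + weightCost ε y) / 2 := by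
  have h₁ := sum_midpoint_add_sum_sq ε x.1 y.1
  have h₂ := sum_midpoint_add_sum_sq ε x.2.1 y.2.1
  have h₃ := sum_midpoint_add_sum_sq ε x.2.2 y.2.2
  simp only [weightCost, Prod.smul_fst, Prod.smul_snd, Prod.fst_add, Prod.snd_add, Pi.smul_apply,
    Pi.add_apply, smul_eq_mul]
  linarith

theorem continuous_weightCost {ι₁ ι₂ ι₃ : Type*} [Fintype ι₁] [Fintype ι₂] [Fintype ι₃] (ε : ℝ) :
    Continuous (weightCost (ι₁ := ι₁) (ι₂ := ι₂) (ι₃ := ι₃) ε) := by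
  unfold weightCost
  fun_prop

theorem exists_min_weightCost {K V₁ V₂ V₃ ι₁ ι₂ ι₃ : Type*} [Field K] [AddCommGroup V₁]
    [Module K V₁] [AddCommGroup V₂] [Module K V₂] [AddCommGroup V₃] [Module K V₃] [Fintype ι₁]
    [Fintype ι₂] [Fintype ι₃] (T : V₁ →ₗ[K] V₂ →ₗ[K] V₃ →ₗ[K] K) (c₁ : Module.Basis ι₁ K V₁)
    (c₂ : Module.Basis ι₂ K V₂) (c₃ : Module.Basis ι₃ K V₃) (ε : ℝ) :
    ∃ (b₁ : Module.Basis ι₁ K V₁) (b₂ : Module.Basis ι₂ K V₂) (b₃ : Module.Basis ι₃ K V₃),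
      ∃ x ∈ Set.Icc 0 1, IsFeasible T b₁ b₂ b₃ x ∧
        ∀ (d₁ : Module.Basis ι₁ K V₁) (d₂ : Module.Basis ι₂ K V₂) (d₃ : Module.Basis ι₃ K V₃),
          ∀ y ∈ Set.Icc 0 1, IsFeasible T d₁ d₂ d₃ y → weightCost ε x ≤ weightCost ε y := by
  let R : Set (Set (ι₁ × ι₂ × ι₃)) := Set.range
    fun b : Module.Basis ι₁ K V₁ × Module.Basis ι₂ K V₂ × Module.Basis ι₃ K V₃ =>
      {p | T (b.1 p.1) (b.2.1 p.2.1) (b.2.2 p.2.2) ≠ 0}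
  let A : Set ((ι₁ → ℝ) × (ι₂ → ℝ) × (ι₃ → ℝ)) := ⋃ S ∈ R,
    Set.Icc 0 1 ∩ {x | ∀ p ∈ S, 1 ≤ x.1 p.1 + x.2.1 p.2.1 + x.2.2 p.2.2}
  have hA : IsCompact A := by
    refine (Set.toFinite R).isCompact_biUnion fun S _ => ?_
    refine isCompact_Icc.inter_right ?_
    simp only [Set.ofPred_forall]
    refine isClosed_biInter fun p _ => isClosed_le continuous_const (by fun_prop)
  have hmem : ∀ x, x ∈ A ↔ ∃ (b₁ : Module.Basis ι₁ K V₁) (b₂ : Module.Basis ι₂ K V₂)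
      (b₃ : Module.Basis ι₃ K V₃), x ∈ Set.Icc 0 1 ∧ IsFeasible T b₁ b₂ b₃ x := by
    intro x
    simp only [A, R, Set.mem_iUnion, exists_prop, Set.exists_range_iff]
    constructor
    · rintro ⟨⟨b₁, b₂, b₃⟩, hx, h⟩
      exact ⟨b₁, b₂, b₃, hx, fun i j k hne => h (i, j, k) hne⟩
    · rintro ⟨b₁, b₂, b₃, hx, h⟩
      exact ⟨⟨b₁, b₂, b₃⟩, hx, fun p hp => h _ _ _ hp⟩
  have hne : A.Nonempty := ⟨1, (hmem 1).mpr ⟨c₁, c₂, c₃, ⟨zero_le_one, le_rfl⟩,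
    fun i j k _ => by norm_num⟩⟩
  obtain ⟨x, hx, hmin⟩ := hA.exists_isMinOn hne (continuous_weightCost ε).continuousOn
  obtain ⟨b₁, b₂, b₃, hx01, hf⟩ := (hmem x).mp hx
  exact ⟨b₁, b₂, b₃, x, hx01, hf, fun d₁ d₂ d₃ y hy hfy =>
    hmin ((hmem y).mpr ⟨d₁, d₂, d₃, hy, hfy⟩)⟩

/-- Two optimal weighted bases define the same filtrations. -/
theorem levelSpan_eq_of_isMin {K V₁ V₂ V₃ : Type*} [Field K] [AddCommGroup V₁]
    [Module K V₁] [AddCommGroup V₂] [Module K V₂] [AddCommGroup V₃] [Module K V₃] {n₁ n₂ n₃ : ℕ}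
    (T : V₁ →ₗ[K] V₂ →ₗ[K] V₃ →ₗ[K] K) {ε : ℝ} (hε : 0 < ε)
    (b₁ b₁' : Module.Basis (Fin n₁) K V₁) (b₂ b₂' : Module.Basis (Fin n₂) K V₂)
    (b₃ b₃' : Module.Basis (Fin n₃) K V₃)
    {x x' : (Fin n₁ → ℝ) × (Fin n₂ → ℝ) × (Fin n₃ → ℝ)}
    (hx : x ∈ Set.Icc 0 1) (hx' : x' ∈ Set.Icc 0 1)
    (hf : IsFeasible T b₁ b₂ b₃ x) (hf' : IsFeasible T b₁' b₂' b₃' x')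
    (hmin : ∀ (d₁ : Module.Basis (Fin n₁) K V₁) (d₂ : Module.Basis (Fin n₂) K V₂)
      (d₃ : Module.Basis (Fin n₃) K V₃), ∀ y ∈ Set.Icc 0 1, IsFeasible T d₁ d₂ d₃ y →
        weightCost ε x ≤ weightCost ε y)
    (hle : weightCost ε x' ≤ weightCost ε x) (s : ℝ) :
    levelSpan (K := K) b₁ x.1 s = levelSpan b₁' x'.1 s ∧
    levelSpan (K := K) b₂ x.2.1 s = levelSpan b₂' x'.2.1 s ∧
    levelSpan (K := K) b₃ x.2.2 s = levelSpan b₃' x'.2.2 s := by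
  obtain ⟨e₁, π₁, π₁', h₁⟩ := exists_common_basis b₁ b₁' x.1 x'.1
  obtain ⟨e₂, π₂, π₂', h₂⟩ := exists_common_basis b₂ b₂' x.2.1 x'.2.1
  obtain ⟨e₃, π₃, π₃', h₃⟩ := exists_common_basis b₃ b₃' x.2.2 x'.2.2
  obtain ⟨y, hy⟩ : ∃ y, y = (x.1 ∘ π₁, x.2.1 ∘ π₂, x.2.2 ∘ π₃) := ⟨_, rfl⟩
  obtain ⟨y', hy'⟩ : ∃ y', y' = (x'.1 ∘ π₁', x'.2.1 ∘ π₂', x'.2.2 ∘ π₃') := ⟨_, rfl⟩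
  have hfy : IsFeasible T e₁ e₂ e₃ y := by
    rw [isFeasible_iff] at hf ⊢
    simpa only [hy, (h₁ _).1, (h₂ _).1, (h₃ _).1] using hf
  have hfy' : IsFeasible T e₁ e₂ e₃ y' := by
    rw [isFeasible_iff] at hf' ⊢
    simpa only [hy', (h₁ _).2, (h₂ _).2, (h₃ _).2] using hf'
  have hcy : weightCost ε y = weightCost ε x := hy ▸ weightCost_comp_equiv ε x π₁ π₂ π₃
  have hcy' : weightCost ε y' = weightCost ε x' := hy' ▸ weightCost_comp_equiv ε x' π₁' π₂' π₃'
  have hIcc : y ∈ Set.Icc 0 1 := by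
    rw [hy]
    exact ⟨⟨fun i => hx.1.1 (π₁ i), fun i => hx.1.2.1 (π₂ i),
      fun i => hx.1.2.2 (π₃ i)⟩,
      ⟨fun i => hx.2.1 (π₁ i), fun i => hx.2.2.1 (π₂ i),
      fun i => hx.2.2.2 (π₃ i)⟩⟩
  have hIcc' : y' ∈ Set.Icc 0 1 := by
    rw [hy']
    exact ⟨⟨fun i => hx'.1.1 (π₁' i), fun i => hx'.1.2.1 (π₂' i),
      fun i => hx'.1.2.2 (π₃' i)⟩,
      ⟨fun i => hx'.2.1 (π₁' i), fun i => hx'.2.2.1 (π₂' i),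
      fun i => hx'.2.2.2 (π₃' i)⟩⟩
  have hIccz : (1 / 2 : ℝ) • (y + y') ∈ Set.Icc 0 1 := by
    have := (convex_Icc (𝕜 := ℝ) (0 : (Fin n₁ → ℝ) × (Fin n₂ → ℝ) × (Fin n₃ → ℝ)) 1) hIcc hIcc'
      (by norm_num : (0 : ℝ) ≤ 1 / 2) (by norm_num : (0 : ℝ) ≤ 1 / 2) (by norm_num)
    rwa [← smul_add] at this
  have hfz : IsFeasible T e₁ e₂ e₃ ((1 / 2 : ℝ) • (y + y')) := by
    intro i j k hne
    have a := hfy i j k hne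
    have a' := hfy' i j k hne
    simp only [Prod.smul_fst, Prod.smul_snd, Prod.fst_add, Prod.snd_add, Pi.smul_apply,
      Pi.add_apply, smul_eq_mul]
    linarith
  have hz := hmin e₁ e₂ e₃ _ hIccz hfz
  have hmid := weightCost_midpoint ε y y'
  have p₁ : 0 ≤ ∑ i, (y.1 i - y'.1 i) ^ 2 := Finset.sum_nonneg fun i _ => sq_nonneg _
  have p₂ : 0 ≤ ∑ i, (y.2.1 i - y'.2.1 i) ^ 2 := Finset.sum_nonneg fun i _ => sq_nonneg _
  have p₃ : 0 ≤ ∑ i, (y.2.2 i - y'.2.2 i) ^ 2 := Finset.sum_nonneg fun i _ => sq_nonneg _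
  have hsum : 2 * ∑ i, (y.1 i - y'.1 i) ^ 2 + ∑ j, (y.2.1 j - y'.2.1 j) ^ 2 +
      ∑ k, (y.2.2 k - y'.2.2 k) ^ 2 ≤ 0 := by
    by_contra hpos
    have := mul_pos (by positivity : 0 < ε / 4) (not_le.mp hpos)
    linarith
  have zero : ∀ {n : ℕ} (a c : Fin n → ℝ), ∑ i, (a i - c i) ^ 2 ≤ 0 → a = c := by
    intro n a c h
    funext i
    have h0 := (Finset.sum_eq_zero_iff_of_nonneg fun i _ => sq_nonneg (a i - c i)).mp
      (h.antisymm (Finset.sum_nonneg fun i _ => sq_nonneg _)) i (Finset.mem_univ i)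
    exact sub_eq_zero.mp (pow_eq_zero_iff two_ne_zero |>.mp h0)
  have q₁ := zero y.1 y'.1 (by linarith)
  have q₂ := zero y.2.1 y'.2.1 (by linarith)
  have q₃ := zero y.2.2 y'.2.2 (by linarith)
  simp only [hy, hy'] at q₁ q₂ q₃
  rw [← (h₁ s).1, ← (h₁ s).2, ← (h₂ s).1, ← (h₂ s).2, ← (h₃ s).1, ← (h₃ s).2, q₁, q₂, q₃]
  exact ⟨rfl, rfl, rfl⟩

theorem setIntegral_indicator_one_le {s t : Set ℝ} {a b : ℝ} (hab : a ≤ b) (ht : MeasurableSet t)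
    (h : t ∩ s ⊆ Set.Icc a b) : ∫ u in s, t.indicator (fun _ => (1 : ℝ)) u ≤ b - a := by
  rw [MeasureTheory.integral_indicator_const _ ht, smul_eq_mul, mul_one,
    MeasureTheory.measureReal_restrict_apply ht]
  refine (MeasureTheory.measureReal_mono h (by simp)).trans ?_
  rw [Real.volume_real_Icc_of_le hab]

/-- An averaged threshold: some `u` makes the number of `a i ≥ u` plus the number of
`b k ≥ c - u` at most the total weight divided by `c`. -/
theorem exists_threshold {ι κ : Type*} [Fintype ι] [Fintype κ] {a : ι → ℝ} {b : κ → ℝ}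
    (ha : 0 ≤ a) (hb : 0 ≤ b) {c : ℝ} (hc : 0 < c) :
    ∃ u : ℝ, c * (((Finset.univ.filter fun i => u ≤ a i).card : ℝ) +
      (Finset.univ.filter fun k => c - u ≤ b k).card) ≤ ∑ i, a i + ∑ k, b k := by
  let f : ℝ → ℝ := fun u => ∑ i, (Set.Iic (a i)).indicator (fun _ => (1 : ℝ)) u +
    ∑ k, (Set.Ici (c - b k)).indicator (fun _ => (1 : ℝ)) u
  have hvol : MeasureTheory.volume (Set.Ioc 0 c) ≠ ⊤ := by simp
  have hi : ∀ t : Set ℝ, MeasurableSet t →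
      MeasureTheory.IntegrableOn (t.indicator fun _ => (1 : ℝ)) (Set.Ioc 0 c) := fun t ht =>
    (MeasureTheory.integrableOn_const hvol).indicator ht
  have hia : MeasureTheory.IntegrableOn
      (fun u => ∑ i, (Set.Iic (a i)).indicator (fun _ => (1 : ℝ)) u) (Set.Ioc 0 c) :=
    MeasureTheory.integrable_finsetSum _ fun i _ => hi _ measurableSet_Iic
  have hib : MeasureTheory.IntegrableOn
      (fun u => ∑ k, (Set.Ici (c - b k)).indicator (fun _ => (1 : ℝ)) u) (Set.Ioc 0 c) :=
    MeasureTheory.integrable_finsetSum _ fun k _ => hi _ measurableSet_Ici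
  obtain ⟨u, -, hu⟩ := MeasureTheory.exists_le_setAverage (f := f) (s := Set.Ioc 0 c)
    (by simp [hc]) hvol (hia.add hib)
  refine ⟨u, ?_⟩
  have hInt : ∫ u in Set.Ioc 0 c, f u ≤ ∑ i, a i + ∑ k, b k := by
    rw [MeasureTheory.integral_add hia hib,
      MeasureTheory.integral_finsetSum _ fun i _ => hi _ measurableSet_Iic,
      MeasureTheory.integral_finsetSum _ fun k _ => hi _ measurableSet_Ici]
    refine add_le_add (Finset.sum_le_sum fun i _ => ?_) (Finset.sum_le_sum fun k _ => ?_)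
    · refine (setIntegral_indicator_one_le (ha i) measurableSet_Iic ?_).trans_eq (sub_zero _)
      exact fun v hv => ⟨hv.2.1.le, hv.1⟩
    · refine (setIntegral_indicator_one_le (sub_le_self c (hb k)) measurableSet_Ici ?_).trans_eq
        (sub_sub_cancel _ _)
      exact fun v hv => ⟨hv.1, hv.2.2⟩
  rw [MeasureTheory.setAverage_eq, Real.volume_real_Ioc_of_le hc.le, sub_zero, smul_eq_mul,
    ← div_eq_inv_mul, le_div_iff₀' hc] at hu
  refine le_trans (le_of_eq ?_) (hu.trans hInt)
  simp only [f, Set.indicator_apply, Set.mem_Iic, Set.mem_Ici, Finset.sum_boole]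
  simp only [sub_le_comm]

theorem card_filter_le_three_mul_sum {ι : Type*} [Fintype ι] {a : ι → ℝ} (ha : 0 ≤ a) :
    ((Finset.univ.filter fun i => 1 / 3 ≤ a i).card : ℝ) ≤ 3 * ∑ i, a i := by
  rw [Finset.mul_sum, ← Finset.sum_boole]
  refine Finset.sum_le_sum fun i _ => ?_
  have := ha i
  simp only [Pi.zero_apply] at this
  split_ifs <;> linarith

theorem finrank_levelSpan {K V ι : Type*} [Field K] [AddCommGroup V] [Module K V] [Fintype ι]
    (b : Module.Basis ι K V) (x : ι → ℝ) (s : ℝ) :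
    Module.finrank K (levelSpan (K := K) b x s) + (Finset.univ.filter fun i => s ≤ x i).card =
      Fintype.card ι := by
  classical
  have hset : b '' {i | x i < s} = ((Finset.univ.filter fun i => x i < s).image b : Finset V) := by
    simp
  rw [levelSpan, hset, finrank_span_finset_eq_card, Finset.card_image_of_injective _ b.injective]
  · simp only [← not_lt (b := s)]
    exact Finset.card_filter_add_card_filter_not _
  · rw [← hset]
    exact (b.linearIndependent.linearIndepOn _).id_image

/-- Rounding an optimal fractional solution to a triple of level spans. -/
theorem exists_levelSpan_block {K V₁ V₂ V₃ ι₁ ι₂ ι₃ : Type*} [Field K] [AddCommGroup V₁]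
    [Module K V₁] [AddCommGroup V₂] [Module K V₂] [AddCommGroup V₃] [Module K V₃] [Fintype ι₁]
    [Fintype ι₂] [Fintype ι₃] (b₁ : Module.Basis ι₁ K V₁)
    (b₂ : Module.Basis ι₂ K V₂) (b₃ : Module.Basis ι₃ K V₃) {x : (ι₁ → ℝ) × (ι₂ → ℝ) × (ι₃ → ℝ)}
    (hx : 0 ≤ x) {ε : ℝ} (hε : 0 ≤ ε) {g : ℕ} (hg : 3 * weightCost ε x < 6 * g + 2) :
    ∃ s₁ s₂ s₃ : ℝ, s₁ + s₂ + s₃ ≤ 1 ∧ Fintype.card ι₁ + Fintype.card ι₂ + Fintype.card ι₃ ≤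
      3 * g + (Module.finrank K (levelSpan (K := K) b₁ x.1 s₁) +
        Module.finrank K (levelSpan (K := K) b₂ x.2.1 s₂) +
        Module.finrank K (levelSpan (K := K) b₃ x.2.2 s₃)) := by
  obtain ⟨u, hu⟩ := exists_threshold hx.2.1 hx.2.2 (by norm_num : (0 : ℝ) < 2 / 3)
  have h₁ := card_filter_le_three_mul_sum hx.1
  refine ⟨1 / 3, u, 2 / 3 - u, by linarith, ?_⟩
  rw [← finrank_levelSpan b₁ x.1 (1 / 3), ← finrank_levelSpan b₂ x.2.1 u,
    ← finrank_levelSpan b₃ x.2.2 (2 / 3 - u)]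
  have hcost : 2 * ∑ i, x.1 i + ∑ j, x.2.1 j + ∑ k, x.2.2 k ≤ weightCost ε x := by
    unfold weightCost
    gcongr <;> nlinarith
  have hlt : (Finset.univ.filter fun i => 1 / 3 ≤ x.1 i).card +
      (Finset.univ.filter fun i => u ≤ x.2.1 i).card +
      (Finset.univ.filter fun i => 2 / 3 - u ≤ x.2.2 i).card < 3 * g + 1 := by
    have : ((Finset.univ.filter fun i => 1 / 3 ≤ x.1 i).card : ℝ) +
      (Finset.univ.filter fun i => u ≤ x.2.1 i).card +
      (Finset.univ.filter fun i => 2 / 3 - u ≤ x.2.2 i).card < 3 * g + 1 := by linarith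
    exact_mod_cast this
  omega

/-- The basis obtained by applying a field automorphism to all coordinates. -/
noncomputable def galoisBasis {F K : Type*} [Field F] [Field K] [Algebra F K] {n : ℕ}
    (σ : K ≃ₐ[F] K) (b : Module.Basis (Fin n) K (Fin n → K)) :
    Module.Basis (Fin n) K (Fin n → K) :=
  basisOfLinearIndependentOfCardEqFinrank' (fun i j => σ (b i j)) (by
    have h := (linearIndependent_iff_isUnit_det b).mp b.linearIndependent
    rw [linearIndependent_iff_isUnit_det]
    have h' := h.map σ
    rwa [AlgEquiv.map_det] at h') (by simp)

theorem galoisBasis_apply {F K : Type*} [Field F] [Field K] [Algebra F K] {n : ℕ}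
    (σ : K ≃ₐ[F] K) (b : Module.Basis (Fin n) K (Fin n → K)) (i : Fin n) :
    galoisBasis σ b i = fun j => σ (b i j) := by
  simp [galoisBasis]

theorem galois_mem_levelSpan {F K : Type*} [Field F] [Field K] [Algebra F K] {n : ℕ}
    (σ : K ≃ₐ[F] K) (b : Module.Basis (Fin n) K (Fin n → K)) (x : Fin n → ℝ) (s : ℝ)
    {v : Fin n → K} (hv : v ∈ levelSpan (K := K) b x s) :
    (fun j => σ (v j)) ∈ levelSpan (K := K) (galoisBasis σ b) x s := by
  induction hv using Submodule.span_induction with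
  | mem v hv =>
    obtain ⟨i, hi, rfl⟩ := hv
    exact Submodule.subset_span ⟨i, hi, galoisBasis_apply σ b i⟩
  | zero =>
    simp only [Pi.zero_apply, map_zero]
    exact (levelSpan (K := K) (galoisBasis σ b) x s).zero_mem
  | add u v _ _ hu hv => simpa [Pi.add_def] using add_mem hu hv
  | smul c v _ hv => simpa [Pi.smul_def] using Submodule.smul_mem _ (σ c) hv

theorem isFeasible_galoisBasis {F K : Type*} [Field F] [Field K] [Algebra F K] {n₁ n₂ n₃ : ℕ}
    (M : Fin n₁ → Fin n₂ → Fin n₃ → F) (σ : K ≃ₐ[F] K)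
    (b₁ : Module.Basis (Fin n₁) K (Fin n₁ → K)) (b₂ : Module.Basis (Fin n₂) K (Fin n₂ → K))
    (b₃ : Module.Basis (Fin n₃) K (Fin n₃ → K))
    {x : (Fin n₁ → ℝ) × (Fin n₂ → ℝ) × (Fin n₃ → ℝ)}
    (h : IsFeasible (triForm fun i j k => algebraMap F K (M i j k)) b₁ b₂ b₃ x) :
    IsFeasible (triForm fun i j k => algebraMap F K (M i j k))
      (galoisBasis σ b₁) (galoisBasis σ b₂) (galoisBasis σ b₃) x := by
  intro i j k hne
  refine h i j k fun h0 => hne ?_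
  have h1 := map_triForm (σ : K →+* K) (fun i j k => algebraMap F K (M i j k)) (b₁ i) (b₂ j) (b₃ k)
  rw [h0, map_zero] at h1
  simpa [galoisBasis_apply] using h1.symm

theorem sum_indicator_cost {ι : Type*} [Fintype ι] [DecidableEq ι] (ε : ℝ) (S : Finset ι) :
    ∑ i, ((if i ∈ S then 0 else 1) + ε * (if i ∈ S then 0 else 1) ^ 2 : ℝ) =
      (1 + ε) * (Fintype.card ι - S.card) := by
  have h : ∀ i, ((if i ∈ S then 0 else 1) + ε * (if i ∈ S then 0 else 1) ^ 2 : ℝ) =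
      (1 + ε) - if i ∈ S then (1 + ε) else 0 := by
    intro i
    split_ifs <;> ring
  simp only [h, Finset.sum_sub_distrib, Finset.sum_ite_mem, Finset.univ_inter, Finset.sum_const,
    nsmul_eq_mul, Finset.card_univ]
  ring

theorem weightCost_indicator {ι₁ ι₂ ι₃ : Type*} [Fintype ι₁] [Fintype ι₂] [Fintype ι₃]
    [DecidableEq ι₁] [DecidableEq ι₂] [DecidableEq ι₃] (ε : ℝ) (S₁ : Finset ι₁) (S₂ : Finset ι₂)
    (S₃ : Finset ι₃) :
    weightCost ε (fun i => if i ∈ S₁ then 0 else 1, fun j => if j ∈ S₂ then 0 else 1,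
        fun k => if k ∈ S₃ then 0 else 1) =
      (1 + ε) * (2 * (Fintype.card ι₁ - S₁.card) + (Fintype.card ι₂ - S₂.card) +
        (Fintype.card ι₃ - S₃.card)) := by
  simp only [weightCost, sum_indicator_cost]
  ring

/-- A zero block over `K` of a tensor defined over `F` yields a Galois-stable zero block, at the
cost of a constant factor in the codimension. -/
theorem exists_invariant_block {F K : Type*} [Field F] [Field K] [Algebra F K] {n₁ n₂ n₃ g : ℕ}
    (M : Fin n₁ → Fin n₂ → Fin n₃ → F)
    (c₁ : Module.Basis (Fin n₁) K (Fin n₁ → K)) (c₂ : Module.Basis (Fin n₂) K (Fin n₂ → K))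
    (c₃ : Module.Basis (Fin n₃) K (Fin n₃ → K))
    (S₁ : Finset (Fin n₁)) (S₂ : Finset (Fin n₂)) (S₃ : Finset (Fin n₃))
    (hzero : ∀ i ∈ S₁, ∀ j ∈ S₂, ∀ k ∈ S₃,
      triForm (fun i j k => algebraMap F K (M i j k)) (c₁ i) (c₂ j) (c₃ k) = 0)
    (hg : 2 * n₁ + n₂ + n₃ ≤ 2 * g + (2 * S₁.card + S₂.card + S₃.card)) :
    ∃ (U₁ : Submodule K (Fin n₁ → K)) (U₂ : Submodule K (Fin n₂ → K))
      (U₃ : Submodule K (Fin n₃ → K)),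
      (∀ u ∈ U₁, ∀ v ∈ U₂, ∀ w ∈ U₃,
        triForm (fun i j k => algebraMap F K (M i j k)) u v w = 0) ∧
      (∀ σ : K ≃ₐ[F] K, (∀ u ∈ U₁, (fun i => σ (u i)) ∈ U₁) ∧
        (∀ v ∈ U₂, (fun i => σ (v i)) ∈ U₂) ∧ ∀ w ∈ U₃, (fun i => σ (w i)) ∈ U₃) ∧
      n₁ + n₂ + n₃ ≤
        3 * g + (Module.finrank K U₁ + Module.finrank K U₂ + Module.finrank K U₃) := by
  set T := triForm fun i j k => algebraMap F K (M i j k) with hT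
  obtain ⟨ε, hε⟩ : ∃ ε : ℝ, ε = 1 / (3 * g + 1) := ⟨_, rfl⟩
  have hε0 : 0 < ε := by rw [hε]; positivity
  obtain ⟨b₁, b₂, b₃, x, hx, hf, hmin⟩ := exists_min_weightCost T c₁ c₂ c₃ ε
  have hcost : 3 * weightCost ε x < 6 * g + 2 := by
    have hle := hmin c₁ c₂ c₃ (fun i => if i ∈ S₁ then 0 else 1, fun j => if j ∈ S₂ then 0 else 1,
      fun k => if k ∈ S₃ then 0 else 1) ?_ ?_
    · rw [weightCost_indicator] at hle
      simp only [Fintype.card_fin] at hle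
      have hg' : (2 * n₁ + n₂ + n₃ : ℝ) ≤ 2 * g + (2 * S₁.card + S₂.card + S₃.card) := by
        exact_mod_cast hg
      have h1 : weightCost ε x ≤ (1 + ε) * (2 * g) :=
        hle.trans (mul_le_mul_of_nonneg_left (by linarith) (by linarith))
      have h2 : ε * (3 * g) < 1 := by
        rw [hε, one_div_mul_eq_div, div_lt_one (by positivity)]
        linarith
      linarith
    · refine ⟨⟨fun i => ?_, fun i => ?_, fun i => ?_⟩, ⟨fun i => ?_, fun i => ?_, fun i => ?_⟩⟩ <;>
      · dsimp
        split_ifs <;> norm_num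
    · intro i j k hne
      by_cases h₁ : i ∈ S₁ <;> by_cases h₂ : j ∈ S₂ <;> by_cases h₃ : k ∈ S₃ <;>
        simp [h₁, h₂, h₃]
      exact (hne (hzero i h₁ j h₂ k h₃)).elim
  obtain ⟨s₁, s₂, s₃, hs, hcard⟩ := exists_levelSpan_block b₁ b₂ b₃ hx.1 hε0.le hcost
  refine ⟨levelSpan b₁ x.1 s₁, levelSpan b₂ x.2.1 s₂, levelSpan b₃ x.2.2 s₃,
    (isFeasible_iff T b₁ b₂ b₃ x).mp hf s₁ s₂ s₃ hs, fun σ => ?_, by simpa using hcard⟩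
  have h := levelSpan_eq_of_isMin T hε0 b₁ (galoisBasis σ b₁) b₂ (galoisBasis σ b₂) b₃
    (galoisBasis σ b₃) hx hx hf (isFeasible_galoisBasis M σ b₁ b₂ b₃ hf) hmin le_rfl
  refine ⟨fun u hu => ?_, fun v hv => ?_, fun w hw => ?_⟩
  · rw [(h s₁).1]
    exact galois_mem_levelSpan σ b₁ x.1 s₁ hu
  · rw [(h s₂).2.1]
    exact galois_mem_levelSpan σ b₂ x.2.1 s₂ hv
  · rw [(h s₃).2.2]
    exact galois_mem_levelSpan σ b₃ x.2.2 s₃ hw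

/-- A Galois-stable subspace of `K^n` has a basis with coordinates in the base field. -/
theorem exists_basis_of_galois_stable {F K : Type*} [Field F] [Field K] [Algebra F K]
    [IsGalois F K] {n : ℕ} (U : Submodule K (Fin n → K))
    (hU : ∀ σ : K ≃ₐ[F] K, ∀ u ∈ U, (fun i => σ (u i)) ∈ U) :
    ∃ b : Fin n → (Fin n → F), LinearIndependent F b ∧ ∃ S : Finset (Fin n),
      S.card = Module.finrank K U ∧ ∀ i ∈ S, (fun j => algebraMap F K (b i j)) ∈ U := by
  let ρ : Fin n → Module.Dual K U := fun i => (LinearMap.proj i).comp U.subtype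
  have hspan : Submodule.span K (Set.range ρ) = ⊤ := by
    refine Submodule.span_eq_top_of_ne_zero fun u hu => ?_
    by_contra! h
    exact hu (Subtype.ext (funext fun i => h (ρ i) ⟨i, rfl⟩))
  obtain ⟨κ, a, ha, hsp, hli⟩ := exists_linearIndependent' K ρ
  have : Finite κ := Finite.of_injective a ha
  have : Fintype κ := Fintype.ofFinite κ
  rw [hspan] at hsp
  have hcard : Fintype.card κ = Module.finrank K U := by
    rw [← Subspace.dual_finrank_eq]
    exact (Module.finrank_eq_card_basis (Module.Basis.mk hli hsp.ge)).symm
  let φ : U →ₗ[K] (κ → K) := LinearMap.pi fun k => ρ (a k)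
  have hφ : Function.Injective φ := by
    rw [injective_iff_map_eq_zero]
    intro u hu
    have hall : ∀ f : Module.Dual K U, f u = 0 := by
      intro f
      have hf : f ∈ Submodule.span K (Set.range (ρ ∘ a)) := hsp ▸ Submodule.mem_top
      induction hf using Submodule.span_induction with
      | mem f hf =>
        obtain ⟨k, rfl⟩ := hf
        exact congrFun hu k
      | zero => rfl
      | add f g _ _ hf hg => simp [hf, hg]
      | smul c f _ hf => simp [hf]
    exact Subtype.ext (funext fun i => hall (ρ i))
  let e : U ≃ₗ[K] (κ → K) := LinearEquiv.ofInjectiveOfFinrankEq φ hφ (by simp [hcard])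
  classical
  let w : κ → U := fun k => e.symm (Pi.single k 1)
  have hw : ∀ k l, (w k : Fin n → K) (a l) = (Pi.single k 1 : κ → K) l :=
    fun k l => congrFun (e.apply_symm_apply (Pi.single k 1)) l
  have hfix : ∀ k i, ∃ c : F, algebraMap F K c = (w k : Fin n → K) i := by
    intro k i
    refine (InfiniteGalois.mem_range_algebraMap_iff_fixed _).mpr fun σ => ?_
    have h : (⟨_, hU σ _ (w k).2⟩ : U) = w k := by
      refine hφ (funext fun l => ?_)
      change σ ((w k : Fin n → K) (a l)) = (w k : Fin n → K) (a l)
      rw [hw, Pi.single_apply]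
      split_ifs <;> simp
    exact congrFun (congrArg Subtype.val h) i
  choose w' hw' using hfix
  let f : (Fin n → F) →ₗ[F] (Fin n → K) := (Algebra.linearMap F K).compLeft (Fin n)
  have hfw : ∀ k, f (w' k) = w k := fun k => funext fun i => hw' k i
  have hliw : LinearIndependent F w' := by
    rw [Fintype.linearIndependent_iff]
    intro c hc l
    have h := congrArg (algebraMap F K) (congrFun hc (a l))
    simpa [hw', hw, Pi.single_apply] using h
  obtain ⟨b, hb, S, hS, hbS⟩ := exists_linearIndependent_extending (Submodule.span F (Set.range w'))
  refine ⟨b, hb, S, ?_, fun i hi => ?_⟩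
  · rw [hS, ← hcard, finrank_span_eq_card hliw]
  · have hle : Submodule.span F (Set.range w') ≤ (U.restrictScalars F).comap f := by
      rw [Submodule.span_le]
      rintro _ ⟨k, rfl⟩
      change f (w' k) ∈ U
      rw [hfw]
      exact (w k).2
    exact hle (hbS i hi)

theorem apply_eq_sum_repr {F V ι : Type*} [Field F] [AddCommGroup V] [Module F V] [Fintype ι]
    (b : Module.Basis ι F V) (f : V →ₗ[F] F) (v : V) : f v = ∑ p, b.repr v p * f (b p) := by
  conv_lhs => rw [← b.sum_repr v]
  simp only [map_sum, map_smul, smul_eq_mul]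

theorem sliceRank3_le_card {F κ : Type*} [Field F] [Fintype κ] {n₁ n₂ n₃ : ℕ}
    (M : Fin n₁ → Fin n₂ → Fin n₃ → F) (c : κ → Fin n₁ → Fin n₂ → Fin n₃ → F)
    (hc : ∀ t, (∃ (f : Fin n₁ → F) (g : Fin n₂ → Fin n₃ → F), ∀ i j k, c t i j k = f i * g j k) ∨
      (∃ (f : Fin n₂ → F) (g : Fin n₁ → Fin n₃ → F), ∀ i j k, c t i j k = f j * g i k) ∨
      (∃ (f : Fin n₃ → F) (g : Fin n₁ → Fin n₂ → F), ∀ i j k, c t i j k = f k * g i j))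
    (hM : ∀ i j k, M i j k = ∑ t, c t i j k) : sliceRank3 M ≤ Fintype.card κ := by
  refine Nat.sInf_le ⟨c ∘ (Fintype.equivFin κ).symm, fun t => hc _, fun i j k => ?_⟩
  rw [hM]
  exact ((Fintype.equivFin κ).symm.sum_comp fun t => c t i j k).symm

/-- A zero block bounds the slice rank by its total codimension. -/
theorem sliceRank3_le_of_zero_block {F : Type*} [Field F] {n₁ n₂ n₃ : ℕ}
    (M : Fin n₁ → Fin n₂ → Fin n₃ → F) (b₁ : Module.Basis (Fin n₁) F (Fin n₁ → F))
    (b₂ : Module.Basis (Fin n₂) F (Fin n₂ → F)) (b₃ : Module.Basis (Fin n₃) F (Fin n₃ → F))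
    (S₁ : Finset (Fin n₁)) (S₂ : Finset (Fin n₂)) (S₃ : Finset (Fin n₃))
    (hzero : ∀ i ∈ S₁, ∀ j ∈ S₂, ∀ k ∈ S₃, triForm M (b₁ i) (b₂ j) (b₃ k) = 0) :
    sliceRank3 M ≤ S₁ᶜ.card + S₂ᶜ.card + S₃ᶜ.card := by
  set T := triForm M with hT
  let c : (↥S₁ᶜ ⊕ ↥S₂ᶜ) ⊕ ↥S₃ᶜ → Fin n₁ → Fin n₂ → Fin n₃ → F := Sum.elim (Sum.elim
    (fun p i j k => b₁.repr (Pi.single i 1) p * T (b₁ p) (Pi.single j 1) (Pi.single k 1))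
    (fun q i j k => b₂.repr (Pi.single j 1) q *
      ∑ p ∈ S₁, b₁.repr (Pi.single i 1) p * T (b₁ p) (b₂ q) (Pi.single k 1)))
    (fun r i j k => b₃.repr (Pi.single k 1) r *
      ∑ p ∈ S₁, b₁.repr (Pi.single i 1) p *
        ∑ q ∈ S₂, b₂.repr (Pi.single j 1) q * T (b₁ p) (b₂ q) (b₃ r))
  have hcard : Fintype.card ((↥S₁ᶜ ⊕ ↥S₂ᶜ) ⊕ ↥S₃ᶜ) = S₁ᶜ.card + S₂ᶜ.card + S₃ᶜ.card := by
    simp only [Fintype.card_sum, Fintype.card_coe]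
  rw [← hcard]
  refine sliceRank3_le_card M c ?_ fun i j k => ?_
  · rintro ((p | q) | r)
    · exact Or.inl ⟨_, _, fun i j k => rfl⟩
    · exact Or.inr (Or.inl ⟨fun j => b₂.repr (Pi.single j 1) q, fun i k => ∑ p ∈ S₁,
        b₁.repr (Pi.single i 1) p * T (b₁ p) (b₂ q) (Pi.single k 1), fun i j k => rfl⟩)
    · exact Or.inr (Or.inr ⟨fun k => b₃.repr (Pi.single k 1) r, fun i j => ∑ p ∈ S₁,
        b₁.repr (Pi.single i 1) p * ∑ q ∈ S₂, b₂.repr (Pi.single j 1) q *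
          T (b₁ p) (b₂ q) (b₃ r), fun i j k => rfl⟩)
  · have hM : M i j k = T (Pi.single i 1) (Pi.single j 1) (Pi.single k 1) := by
      simp [hT, triForm_apply, Pi.single_apply]
    have e₁ : ∀ v w, T (Pi.single i 1) v w = ∑ p, b₁.repr (Pi.single i 1) p * T (b₁ p) v w :=
      fun v w => apply_eq_sum_repr b₁ ((T.flip v).flip w) _
    have e₂ : ∀ u w, T u (Pi.single j 1) w = ∑ q, b₂.repr (Pi.single j 1) q * T u (b₂ q) w :=
      fun u w => apply_eq_sum_repr b₂ ((T u).flip w) _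
    have e₃ : ∀ u v, T u v (Pi.single k 1) = ∑ r, b₃.repr (Pi.single k 1) r * T u v (b₃ r) :=
      fun u v => apply_eq_sum_repr b₃ (T u v) _
    have h₃ : ∀ p ∈ S₁, ∀ q ∈ S₂, T (b₁ p) (b₂ q) (Pi.single k 1) =
        ∑ r ∈ S₃ᶜ, b₃.repr (Pi.single k 1) r * T (b₁ p) (b₂ q) (b₃ r) := by
      intro p hp q hq
      rw [e₃, ← Finset.sum_add_sum_compl S₃, add_eq_right]
      exact Finset.sum_eq_zero fun r hr => by rw [hzero p hp q hq r hr, mul_zero]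
    have h₂ : ∀ p ∈ S₁, T (b₁ p) (Pi.single j 1) (Pi.single k 1) =
        ∑ q ∈ S₂ᶜ, b₂.repr (Pi.single j 1) q * T (b₁ p) (b₂ q) (Pi.single k 1) +
        ∑ r ∈ S₃ᶜ, b₃.repr (Pi.single k 1) r *
          ∑ q ∈ S₂, b₂.repr (Pi.single j 1) q * T (b₁ p) (b₂ q) (b₃ r) := by
      intro p hp
      rw [e₂, ← Finset.sum_add_sum_compl S₂, add_comm,
        Finset.sum_congr (s₁ := S₂) rfl fun q hq => by rw [h₃ p hp q hq]]
      simp only [Finset.mul_sum]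
      rw [Finset.sum_comm (s := S₂)]
      simp only [mul_left_comm]
    rw [hM, e₁, ← Finset.sum_add_sum_compl S₁, add_comm,
      Finset.sum_congr (s₁ := S₁) rfl fun p hp => by rw [h₂ p hp]]
    simp only [Fintype.sum_sum_type, c, Sum.elim_inl, Sum.elim_inr]
    rw [Finset.sum_coe_sort S₁ᶜ fun p => b₁.repr (Pi.single i 1) p *
        T (b₁ p) (Pi.single j 1) (Pi.single k 1),
      Finset.sum_coe_sort S₂ᶜ fun q => b₂.repr (Pi.single j 1) q *
        ∑ p ∈ S₁, b₁.repr (Pi.single i 1) p * T (b₁ p) (b₂ q) (Pi.single k 1),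
      Finset.sum_coe_sort S₃ᶜ fun r => b₃.repr (Pi.single k 1) r *
        ∑ p ∈ S₁, b₁.repr (Pi.single i 1) p *
          ∑ q ∈ S₂, b₂.repr (Pi.single j 1) q * T (b₁ p) (b₂ q) (b₃ r), add_assoc]
    congr 1
    simp only [mul_add, Finset.sum_add_distrib]
    congr 1
    · simp only [Finset.mul_sum]
      rw [Finset.sum_comm]
      simp only [mul_left_comm]
    · simp only [Finset.mul_sum]
      rw [Finset.sum_comm]
      simp only [mul_left_comm]

/-- A zero block over the algebraic closure whose codimensions are controlled by the dimension of
the variety. -/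
theorem exists_zero_block_of_varDim {K : Type*} [Field K] [IsAlgClosed K] {n₁ n₂ n₃ : ℕ}
    (M : Fin n₁ → Fin n₂ → Fin n₃ → K) {V : Set (Fin (n₁ + n₂) → K)} (hd : varDim V ≠ 0)
    (hV : ∀ x ∈ V, ∀ w, triForm M (fun i => x (Fin.castAdd n₂ i)) (fun j => x (Fin.natAdd n₁ j))
      w = 0) :
    ∃ (c₁ : Fin n₁ → (Fin n₁ → K)) (c₂ : Fin n₂ → (Fin n₂ → K)) (c₃ : Fin n₃ → (Fin n₃ → K)),
      LinearIndependent K c₁ ∧ LinearIndependent K c₂ ∧ LinearIndependent K c₃ ∧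
      ∃ (S₁ : Finset (Fin n₁)) (S₂ : Finset (Fin n₂)) (S₃ : Finset (Fin n₃)),
        (∀ i ∈ S₁, ∀ j ∈ S₂, ∀ k ∈ S₃, triForm M (c₁ i) (c₂ j) (c₃ k) = 0) ∧
        varDim V ≤ S₁.card + S₂.card ∧ S₂.card + n₃ = S₃.card + n₂ := by
  obtain ⟨L, _, _, x, hx, D, hD⟩ := exists_generic_point_of_varDim hd
  have hcoord : ∀ k, ∑ i, ∑ j, algebraMap K L (M i j k) * x (Fin.castAdd n₂ i) *
      x (Fin.natAdd n₁ j) = 0 := by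
    intro k
    have h := hx (∑ i, ∑ j, MvPolynomial.C (M i j k) * MvPolynomial.X (Fin.castAdd n₂ i) *
      MvPolynomial.X (Fin.natAdd n₁ j)) fun v hv => by
        have h0 := hV v hv (Pi.single k 1)
        simpa [triForm_apply, Pi.single_apply] using h0
    simpa using h
  have hx0 : ∀ w, triForm (fun i j k => algebraMap K L (M i j k))
      (fun i => x (Fin.castAdd n₂ i)) (fun j => x (Fin.natAdd n₁ j)) w = 0 := by
    intro w
    rw [triForm_apply]
    simp only [Finset.sum_comm (s := (Finset.univ : Finset (Fin n₂))), ← Finset.sum_mul]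
    rw [Finset.sum_comm]
    simp only [← Finset.sum_mul, hcoord, zero_mul, Finset.sum_const_zero]
  obtain ⟨U₁, U₂, U₃, hU, hd₁, hd₂⟩ := exists_zero_block_of_derivations M x hx0 D hD
  obtain ⟨e₁, he₁, S₁, hS₁, hm₁⟩ := exists_linearIndependent_extending U₁
  obtain ⟨e₂, he₂, S₂, hS₂, hm₂⟩ := exists_linearIndependent_extending U₂
  obtain ⟨e₃, he₃, S₃, hS₃, hm₃⟩ := exists_linearIndependent_extending U₃
  obtain ⟨f₁, f₂, f₃, hf₁, hf₂, hf₃, hf⟩ := exists_zero_block_of_extension M he₁ he₂ he₃ S₁ S₂ S₃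
    fun i hi j hj k hk => hU _ (hm₁ i hi) _ (hm₂ j hj) _ (hm₃ k hk)
  exact ⟨f₁, f₂, f₃, hf₁, hf₂, hf₃, S₁, S₂, S₃, hf, by omega, by omega⟩

/-- A zero block over a Galois extension bounds the slice rank over the base field. -/
theorem sliceRank3_le_of_zero_block_of_isGalois {F K : Type*} [Field F] [Field K] [Algebra F K]
    [IsGalois F K] {n₁ n₂ n₃ g : ℕ} (M : Fin n₁ → Fin n₂ → Fin n₃ → F)
    {c₁ : Fin n₁ → (Fin n₁ → K)} {c₂ : Fin n₂ → (Fin n₂ → K)} {c₃ : Fin n₃ → (Fin n₃ → K)}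
    (h₁ : LinearIndependent K c₁) (h₂ : LinearIndependent K c₂) (h₃ : LinearIndependent K c₃)
    (S₁ : Finset (Fin n₁)) (S₂ : Finset (Fin n₂)) (S₃ : Finset (Fin n₃))
    (hzero : ∀ i ∈ S₁, ∀ j ∈ S₂, ∀ k ∈ S₃,
      triForm (fun i j k => algebraMap F K (M i j k)) (c₁ i) (c₂ j) (c₃ k) = 0)
    (hg : 2 * n₁ + n₂ + n₃ ≤ 2 * g + (2 * S₁.card + S₂.card + S₃.card)) :
    sliceRank3 M ≤ 3 * g := by
  obtain ⟨U₁, U₂, U₃, hU, hσ, hdim⟩ := exists_invariant_block M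
    (basisOfLinearIndependentOfCardEqFinrank' c₁ h₁ (by simp))
    (basisOfLinearIndependentOfCardEqFinrank' c₂ h₂ (by simp))
    (basisOfLinearIndependentOfCardEqFinrank' c₃ h₃ (by simp)) S₁ S₂ S₃ (by simpa using hzero) hg
  obtain ⟨b₁, hb₁, R₁, hR₁, hm₁⟩ := exists_basis_of_galois_stable U₁ fun σ => (hσ σ).1
  obtain ⟨b₂, hb₂, R₂, hR₂, hm₂⟩ := exists_basis_of_galois_stable U₂ fun σ => (hσ σ).2.1
  obtain ⟨b₃, hb₃, R₃, hR₃, hm₃⟩ := exists_basis_of_galois_stable U₃ fun σ => (hσ σ).2.2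
  have hb : ∀ i ∈ R₁, ∀ j ∈ R₂, ∀ k ∈ R₃, triForm M (b₁ i) (b₂ j) (b₃ k) = 0 := by
    intro i hi j hj k hk
    refine (algebraMap F K).injective ?_
    rw [map_triForm, map_zero]
    exact hU _ (hm₁ i hi) _ (hm₂ j hj) _ (hm₃ k hk)
  have h := sliceRank3_le_of_zero_block M
    (basisOfLinearIndependentOfCardEqFinrank' b₁ hb₁ (by simp))
    (basisOfLinearIndependentOfCardEqFinrank' b₂ hb₂ (by simp))
    (basisOfLinearIndependentOfCardEqFinrank' b₃ hb₃ (by simp)) R₁ R₂ R₃ (by simpa using hb)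
  simp only [Finset.card_compl, Fintype.card_fin] at h
  have l₁ := card_finset_fin_le R₁
  have l₂ := card_finset_fin_le R₂
  have l₃ := card_finset_fin_le R₃
  omega

/-- Cohen–Moshkovitz: for any 3-tensor over a perfect field `F`, `SR(T) ≤ 3·GR(T)`, where
`GR(T)` is the codimension over the algebraic closure of `{(x₁,x₂) : T(x₁,x₂,·) ≡ 0}`. -/
theorem sliceRank_le_three_mul_geometricRank (F : Type*) [Field F] [PerfectField F]
    (n₁ n₂ n₃ : ℕ) (M : Fin n₁ → Fin n₂ → Fin n₃ → F)
    (V : Set (Fin (n₁ + n₂) → AlgebraicClosure F))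
    (hV : V = {x | ∀ z : Fin n₃ → AlgebraicClosure F,
      ∑ i : Fin n₁, ∑ j : Fin n₂, ∑ k : Fin n₃,
        algebraMap F (AlgebraicClosure F) (M i j k) *
          x (Fin.castAdd n₂ i) * x (Fin.natAdd n₁ j) * z k = 0}) :
    sliceRank3 M ≤ 3 * (n₁ + n₂ - varDim V) := by
  rcases eq_or_ne (varDim V) 0 with hd | hd
  · have h := sliceRank3_le_of_zero_block M (Pi.basisFun F (Fin n₁)) (Pi.basisFun F (Fin n₂))
      (Pi.basisFun F (Fin n₃)) ∅ Finset.univ Finset.univ (by simp)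
    simp only [Finset.compl_empty, Finset.compl_univ, Finset.card_univ, Fintype.card_fin,
      Finset.card_empty] at h
    omega
  · obtain ⟨c₁, c₂, c₃, h₁, h₂, h₃, S₁, S₂, S₃, hzero, hdim, hcard⟩ :=
      exists_zero_block_of_varDim (fun i j k => algebraMap F (AlgebraicClosure F) (M i j k)) hd
        (fun x hx w => by
          rw [hV] at hx
          rw [triForm_apply]
          exact hx w)
    refine sliceRank3_le_of_zero_block_of_isGalois M h₁ h₂ h₃ S₁ S₂ S₃ hzero ?_
    have l₁ := card_finset_fin_le S₁
    have l₂ := card_finset_fin_le S₂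
    omega
end
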